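/- arXiv:2309.16966 — 2 statements merged into one kernel-verified Lean document; each statement's English description precedes it below -/
import Mathlib

section
/- Let a, b be nonzero real numbers with a³ ≠ b³, let k ≥ 0 be an integer, and set θ = 2π/3, δ = π/3. Then the Cauchy principal value (at the unique zero t = |a| of one of the cubic factors) of ∫₀^∞ (log t)^k · [ t(t+a)/((t³ − a³)(t² + b t + b²)) + t(t−a)/((t³ + a³)(t² − b t + b²)) ] dt equals (θ^{k+1}/(3(a²+ab+b²))) [ −R_k(log|a|/θ) + 3 R_k(log|b|/θ) + Y_k(log|a|/θ) ] + (θ^{k+1}(a+b)/(√3(a³−b³))) [ S_k(log|a|/θ) − S_k(log|b|/θ) ] + (δ^{k+1}/(3(a²+ab+b²))) [ −P_k(log|a|/δ) + 3 P_k(log|b|/δ) + Z_k(log|a|/δ) ] + (δ^{k+1}(a+b)/(√3(a³−b³))) [ Q_k(log|a|/δ) − Q_k(log|b|/δ) ]. -/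
open Finset

/-- Non-recursive part of `Rpoly`. -/
noncomputable def GR (k : ℕ) : Polynomial ℝ :=
  Polynomial.C ((1 : ℝ) / (2 * (k + 1))) *
    ∑ j ∈ (Finset.range (k + 2)).filter (fun j => Even j),
      Polynomial.C ((-1 : ℝ) ^ (j / 2) * ((k + 1).choose j : ℝ) * ((2 : ℝ) ^ j + 1)) *
        Polynomial.X ^ (k + 1 - j)

noncomputable def GS (k : ℕ) : Polynomial ℝ :=
  Polynomial.C ((1 : ℝ) / (2 * (k + 1))) *
    ∑ j ∈ (Finset.range (k + 2)).filter (fun j => Odd j),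
      Polynomial.C ((-1 : ℝ) ^ ((j + 1) / 2) * ((k + 1).choose j : ℝ) * ((2 : ℝ) ^ j - 1)) *
        Polynomial.X ^ (k + 1 - j)

noncomputable def GP (k : ℕ) : Polynomial ℝ :=
  Polynomial.C ((1 : ℝ) / (2 * (k + 1))) *
    ∑ j ∈ (Finset.range (k + 2)).filter (fun j => Even j),
      Polynomial.C ((-1 : ℝ) ^ (j / 2) * ((k + 1).choose j : ℝ) * ((5 : ℝ) ^ j + 1)) *
        Polynomial.X ^ (k + 1 - j)

noncomputable def GQ (k : ℕ) : Polynomial ℝ :=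
  Polynomial.C ((1 : ℝ) / (2 * (k + 1))) *
    ∑ j ∈ (Finset.range (k + 2)).filter (fun j => Odd j),
      Polynomial.C ((-1 : ℝ) ^ ((j - 1) / 2) * ((k + 1).choose j : ℝ) * ((5 : ℝ) ^ j - 1)) *
        Polynomial.X ^ (k + 1 - j)

noncomputable def GY (k : ℕ) : Polynomial ℝ :=
  Polynomial.C (-((1 : ℝ) / (k + 1))) *
    (Polynomial.X ^ (k + 1) +
      ∑ j ∈ (Finset.range (k + 2)).filter (fun j => Even j),
        Polynomial.C ((-1 : ℝ) ^ (j / 2) * ((k + 1).choose j : ℝ) * ((3 : ℝ) ^ j)) *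
          Polynomial.X ^ (k + 1 - j))

noncomputable def GZ (k : ℕ) : Polynomial ℝ :=
  Polynomial.C (-((2 : ℝ) / (k + 1))) *
    ∑ j ∈ (Finset.range (k + 2)).filter (fun j => Even j),
      Polynomial.C ((-1 : ℝ) ^ (j / 2) * ((k + 1).choose j : ℝ) * ((3 : ℝ) ^ j)) *
        Polynomial.X ^ (k + 1 - j)

/-- The common recursion: `F k = (1/(k+1)) ∑_{3 ≤ j ≤ k+1, j odd}
(−1)^{(j+1)/2} C(k+1,j) m^{j−1} F_{k+1−j} + G k`. -/
noncomputable def recFam (m : ℝ) (G : ℕ → Polynomial ℝ) : ℕ → Polynomial ℝ := fun k =>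
  Nat.strongRecOn k fun k ih =>
    Polynomial.C ((1 : ℝ) / (k + 1)) *
      (∑ j ∈ ((Finset.range (k + 2)).filter (fun j => Odd j ∧ 3 ≤ j)).attach,
        Polynomial.C ((-1 : ℝ) ^ ((j.1 + 1) / 2) * ((k + 1).choose j.1 : ℝ) * m ^ (j.1 - 1)) *
          ih (k + 1 - j.1) (by
            have hj := j.2
            simp only [Finset.mem_filter, Finset.mem_range] at hj
            omega))
    + G k

noncomputable def Rpoly : ℕ → Polynomial ℝ := recFam 3 GR
noncomputable def Spoly : ℕ → Polynomial ℝ := recFam 3 GS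
noncomputable def Ppoly : ℕ → Polynomial ℝ := recFam 6 GP
noncomputable def Qpoly : ℕ → Polynomial ℝ := recFam 6 GQ
noncomputable def Ypoly : ℕ → Polynomial ℝ := recFam 3 GY
noncomputable def Zpoly : ℕ → Polynomial ℝ := recFam 6 GZ

open MeasureTheory

namespace CubicLogIntegral

open PowerSeries (rescale)

/-- The exponential generating function of a complex sequence. -/
noncomputable def egf (f : ℕ → ℂ) : PowerSeries ℂ := PowerSeries.mk fun n => f n / (n.factorial : ℂ)

/-- The formal power series `exp (c X)`. -/
noncomputable def expSeries (c : ℂ) : PowerSeries ℂ := egf fun n => c ^ n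

lemma egf_mul (f g : ℕ → ℂ) :
    egf f * egf g = egf fun n => ∑ j ∈ range (n + 1), (n.choose j : ℂ) * f j * g (n - j) := by
  ext n
  simp only [egf, PowerSeries.coeff_mul, PowerSeries.coeff_mk]
  rw [Finset.Nat.sum_antidiagonal_eq_sum_range_succ
    (fun i j => f i / (i.factorial : ℂ) * (g j / (j.factorial : ℂ))), Finset.sum_div]
  refine Finset.sum_congr rfl fun j hj => ?_
  have hj' : j ≤ n := by simp at hj; omega
  rw [Nat.cast_choose ℂ hj']
  have h1 : (j.factorial : ℂ) ≠ 0 := by exact_mod_cast j.factorial_ne_zero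
  have h2 : ((n - j).factorial : ℂ) ≠ 0 := by exact_mod_cast (n - j).factorial_ne_zero
  have h3 : (n.factorial : ℂ) ≠ 0 := by exact_mod_cast n.factorial_ne_zero
  field_simp

lemma egf_add (f g : ℕ → ℂ) : egf f + egf g = egf fun n => f n + g n := by
  ext n; simp [egf, add_div]

lemma egf_sub (f g : ℕ → ℂ) : egf f - egf g = egf fun n => f n - g n := by
  ext n; simp [egf, sub_div]

lemma C_mul_egf (c : ℂ) (f : ℕ → ℂ) : PowerSeries.C c * egf f = egf fun n => c * f n := by
  ext n; simp [egf, mul_div_assoc]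

lemma X_mul_egf (f : ℕ → ℂ) : PowerSeries.X * egf f = egf fun n => n * f (n - 1) := by
  ext n
  cases n with
  | zero => simp [egf]
  | succ n =>
    have h1 : (n.factorial : ℂ) ≠ 0 := by exact_mod_cast n.factorial_ne_zero
    have h2 : (n + 1 : ℂ) ≠ 0 := by exact_mod_cast n.succ_ne_zero
    rw [PowerSeries.coeff_succ_X_mul]
    simp only [egf, PowerSeries.coeff_mk, Nat.factorial_succ, Nat.cast_mul, Nat.cast_add,
      Nat.cast_one, Nat.add_sub_cancel]
    field_simp

lemma egf_injective {f g : ℕ → ℂ} (h : egf f = egf g) (n : ℕ) : f n = g n := by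
  have h1 : (n.factorial : ℂ) ≠ 0 := by exact_mod_cast n.factorial_ne_zero
  have h2 := congrArg (PowerSeries.coeff n) h
  simp only [egf, PowerSeries.coeff_mk] at h2
  field_simp at h2
  exact h2

lemma expSeries_zero : expSeries 0 = 1 := by
  ext n
  cases n <;> simp [expSeries, egf, PowerSeries.coeff_one]

lemma expSeries_add (c d : ℂ) : expSeries (c + d) = expSeries c * expSeries d := by
  rw [expSeries, expSeries, expSeries, egf_mul]
  congr 1
  funext n
  rw [add_pow]
  exact Finset.sum_congr rfl fun j _ => by ring

lemma expSeries_nat_mul (n : ℕ) (c : ℂ) : expSeries (n * c) = expSeries c ^ n := by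
  induction n with
  | zero => simp [expSeries_zero]
  | succ n ih => rw [Nat.cast_succ, add_mul, one_mul, expSeries_add, ih, pow_succ]

lemma expSeries_eq_rescale (c : ℂ) : expSeries c = rescale c (PowerSeries.exp ℂ) := by
  ext n
  simp [expSeries, egf, PowerSeries.coeff_rescale, PowerSeries.coeff_exp, div_eq_mul_inv]

lemma expSeries_sub_one_ne_zero {c : ℂ} (hc : c ≠ 0) : expSeries c - 1 ≠ 0 := by
  intro h
  have := congrArg (PowerSeries.coeff 1) h
  simp [expSeries, egf, PowerSeries.coeff_one] at this
  exact hc this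

lemma egf_bernoulli_mul (c τ : ℂ) :
    egf (fun n => c ^ n * Polynomial.aeval τ (Polynomial.bernoulli n)) * (expSeries c - 1)
      = PowerSeries.X * PowerSeries.C c * expSeries (c * τ) := by
  have h := congrArg (rescale c) (Polynomial.bernoulli_generating_function τ)
  rw [map_mul, map_mul, map_sub, map_one, ← expSeries_eq_rescale, PowerSeries.rescale_X,
    PowerSeries.rescale_rescale, ← expSeries_eq_rescale] at h
  have h1 : egf (fun n => c ^ n * Polynomial.aeval τ (Polynomial.bernoulli n))
      = rescale c (PowerSeries.mk fun n =>
        Polynomial.aeval τ ((1 / n.factorial : ℚ) • Polynomial.bernoulli n)) := by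
    ext n
    simp [egf, PowerSeries.coeff_rescale, Algebra.smul_def, div_eq_mul_inv]
    ring
  rw [h1, h]
  rw [mul_comm τ c]
  ring

/-- The homogenised Bernoulli polynomial sum `∑ C(n, m) l^(n-m) c^m B_m(τ)`. -/
noncomputable def bernSum (c τ l : ℂ) (n : ℕ) : ℂ :=
  ∑ m ∈ range (n + 1),
    (n.choose m : ℂ) * (c ^ m * Polynomial.aeval τ (Polynomial.bernoulli m)) * l ^ (n - m)

lemma egf_bernSum_mul (c τ l : ℂ) :
    egf (bernSum c τ l) * (expSeries c - 1)
      = PowerSeries.X * PowerSeries.C c * expSeries (c * τ) * expSeries l := by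
  have : egf (bernSum c τ l) =
      egf (fun n => c ^ n * Polynomial.aeval τ (Polynomial.bernoulli n)) * expSeries l := by
    rw [expSeries, egf_mul]; rfl
  rw [this, mul_right_comm, egf_bernoulli_mul]

lemma I_pow_add_neg_I_pow (j : ℕ) :
    Complex.I ^ j + (-Complex.I) ^ j = if Even j then 2 * (-1 : ℂ) ^ (j / 2) else 0 := by
  rcases Nat.even_or_odd' j with ⟨m, rfl | rfl⟩
  · have : 2 * m / 2 = m := by omega
    simp [pow_mul, this]; ring
  · have : ¬ Even (2 * m + 1) := by simp
    rw [if_neg this, pow_succ, pow_succ, pow_mul, pow_mul]; simp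

lemma I_pow_sub_neg_I_pow (j : ℕ) :
    Complex.I ^ j - (-Complex.I) ^ j
      = if Odd j then 2 * Complex.I * (-1 : ℂ) ^ ((j - 1) / 2) else 0 := by
  rcases Nat.even_or_odd' j with ⟨m, rfl | rfl⟩
  · have : ¬ Odd (2 * m) := by simp
    rw [if_neg this, pow_mul, pow_mul]; simp
  · have : (2 * m + 1 - 1) / 2 = m := by omega
    have h : Odd (2 * m + 1) := by simp
    rw [if_pos h, pow_succ, pow_succ, pow_mul, pow_mul, this]; simp; ring

lemma recFam_eq (m : ℝ) (G : ℕ → Polynomial ℝ) (k : ℕ) :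
    recFam m G k = Polynomial.C ((1 : ℝ) / (k + 1)) *
      (∑ j ∈ (range (k + 2)).filter (fun j => Odd j ∧ 3 ≤ j),
        Polynomial.C ((-1 : ℝ) ^ ((j + 1) / 2) * ((k + 1).choose j : ℝ) * m ^ (j - 1)) *
          recFam m G (k + 1 - j)) + G k := by
  conv_lhs => rw [recFam, Nat.strongRecOn_eq]
  congr 2
  exact Finset.sum_attach ((range (k + 2)).filter (fun j => Odd j ∧ 3 ≤ j))
    (fun j => Polynomial.C ((-1 : ℝ) ^ ((j + 1) / 2) * ((k + 1).choose j : ℝ) * m ^ (j - 1)) *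
          recFam m G (k + 1 - j))

lemma recFam_eval_eq (m : ℝ) (G : ℕ → Polynomial ℝ) (k : ℕ) (x : ℝ) :
    ∑ j ∈ (range (k + 2)).filter (fun j => Odd j),
        (-1 : ℝ) ^ ((j - 1) / 2) * ((k + 1).choose j : ℝ) * m ^ (j - 1) *
          (recFam m G (k + 1 - j)).eval x = (k + 1) * (G k).eval x := by
  have hk : (k + 1 : ℝ) ≠ 0 := by positivity
  have h := congrArg (Polynomial.eval x) (recFam_eq m G k)
  rw [Polynomial.eval_add, Polynomial.eval_mul, Polynomial.eval_C, Polynomial.eval_finsetSum] at h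
  have hsplit : (range (k + 2)).filter (fun j => Odd j)
      = insert 1 ((range (k + 2)).filter (fun j => Odd j ∧ 3 ≤ j)) := by
    ext j
    simp only [mem_filter, mem_range, mem_insert]
    constructor
    · rintro ⟨h1, h2⟩
      obtain ⟨r, rfl⟩ := h2
      rcases Nat.eq_zero_or_pos r with rfl | hr
      · left; rfl
      · right; exact ⟨h1, ⟨r, rfl⟩, by omega⟩
    · rintro (rfl | ⟨h1, h2, _⟩)
      · exact ⟨by omega, odd_one⟩
      · exact ⟨h1, h2⟩
  rw [hsplit, Finset.sum_insert (by simp)]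
  have hneg : ∑ j ∈ (range (k + 2)).filter (fun j => Odd j ∧ 3 ≤ j),
        (-1 : ℝ) ^ ((j - 1) / 2) * ((k + 1).choose j : ℝ) * m ^ (j - 1) *
          (recFam m G (k + 1 - j)).eval x
      = - ∑ j ∈ (range (k + 2)).filter (fun j => Odd j ∧ 3 ≤ j),
        (Polynomial.C ((-1 : ℝ) ^ ((j + 1) / 2) * ((k + 1).choose j : ℝ) * m ^ (j - 1)) *
          recFam m G (k + 1 - j)).eval x := by
    rw [← Finset.sum_neg_distrib]
    refine Finset.sum_congr rfl fun j hj => ?_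
    obtain ⟨r, rfl⟩ := (Finset.mem_filter.1 hj).2.1
    have h1 : (2 * r + 1 - 1) / 2 = r := by omega
    have h2 : (2 * r + 1 + 1) / 2 = r + 1 := by omega
    rw [Polynomial.eval_mul, Polynomial.eval_C, h1, h2, pow_succ]
    ring
  rw [hneg]
  simp only [Nat.sub_self, Nat.zero_div, pow_zero, Nat.choose_one_right, one_mul, mul_one,
    Nat.add_sub_cancel, Nat.cast_add, Nat.cast_one]
  rw [h]
  field_simp
  ring

/-- The generating-function form of the recursion defining `recFam`. -/
lemma egf_recFam_mul (m θ : ℝ) (G : ℕ → Polynomial ℝ) (x : ℝ) :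
    egf (fun n => ((θ ^ (n + 1) * (recFam m G n).eval x : ℝ) : ℂ)) *
        (expSeries (m * θ * Complex.I) - expSeries (m * θ * -Complex.I))
      = PowerSeries.C (2 * Complex.I * m * θ) *
        egf (fun n => ((θ ^ n * (n * (G (n - 1)).eval x) : ℝ) : ℂ)) := by
  rw [mul_comm, expSeries, expSeries, egf_sub, egf_mul, C_mul_egf]
  congr 1
  funext n
  cases n with
  | zero => simp
  | succ k =>
    have h := congrArg (fun r : ℝ => (r : ℂ)) (recFam_eval_eq m G k x)
    simp only [Complex.ofReal_sum] at h
    push_cast at h ⊢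
    rw [← h, Finset.mul_sum, Finset.mul_sum, Finset.sum_filter]
    refine Finset.sum_congr rfl fun j hj => ?_
    have hj' : j ≤ k + 1 := by simp at hj; omega
    rw [mul_pow, mul_pow (_ * _ : ℂ), ← mul_sub, I_pow_sub_neg_I_pow]
    split_ifs with hodd
    · have h3 : (θ : ℂ) ^ (k + 1 + 1) = θ ^ j * θ ^ (k + 1 - j + 1) := by
        rw [← pow_add]; congr 1; omega
      obtain ⟨r, rfl⟩ := hodd
      have h1 : (m : ℂ) ^ (2 * r + 1) = m ^ (2 * r + 1 - 1) * m := by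
        rw [← pow_succ]; congr 1
      rw [mul_pow, h1]
      linear_combination (-(2 * Complex.I * (-1) ^ ((2 * r + 1 - 1) / 2) *
        ((k + 1).choose (2 * r + 1)) * m ^ (2 * r + 1 - 1) * m *
        (((recFam m G (k + 1 - (2 * r + 1))).eval x : ℝ) : ℂ))) * h3
    · simp

/-- `∑ (-1)^(j/2) C(n, j) r^j x^(n-j)` over even `j`. -/
noncomputable def evenSum (r x : ℝ) (n : ℕ) : ℝ :=
  ∑ j ∈ (range (n + 1)).filter (fun j => Even j),
    (-1 : ℝ) ^ (j / 2) * (n.choose j : ℝ) * r ^ j * x ^ (n - j)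

/-- `∑ (-1)^((j-1)/2) C(n, j) r^j x^(n-j)` over odd `j`. -/
noncomputable def oddSum (r x : ℝ) (n : ℕ) : ℝ :=
  ∑ j ∈ (range (n + 1)).filter (fun j => Odd j),
    (-1 : ℝ) ^ ((j - 1) / 2) * (n.choose j : ℝ) * r ^ j * x ^ (n - j)

lemma egf_evenSum (r x θ : ℝ) :
    PowerSeries.C 2 * egf (fun n => ((θ ^ n * evenSum r x n : ℝ) : ℂ))
      = (expSeries (r * θ * Complex.I) + expSeries (r * θ * -Complex.I)) *
        expSeries (θ * x : ℂ) := by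
  rw [C_mul_egf, expSeries, expSeries, expSeries, egf_add, egf_mul]
  congr 1
  funext n
  rw [evenSum]
  push_cast
  rw [Finset.mul_sum, Finset.mul_sum, Finset.sum_filter]
  refine Finset.sum_congr rfl fun j hj => ?_
  have hj' : j ≤ n := by simp at hj; omega
  have h3 : (θ : ℂ) ^ n = θ ^ j * θ ^ (n - j) := by rw [← pow_add]; congr 1; omega
  rw [mul_pow _ Complex.I, mul_pow _ (-Complex.I), ← mul_add, I_pow_add_neg_I_pow, mul_pow,
    mul_pow, h3]
  split_ifs
  · ring
  · simp

lemma egf_oddSum (r x θ : ℝ) :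
    PowerSeries.C (2 * Complex.I) * egf (fun n => ((θ ^ n * oddSum r x n : ℝ) : ℂ))
      = (expSeries (r * θ * Complex.I) - expSeries (r * θ * -Complex.I)) *
        expSeries (θ * x : ℂ) := by
  rw [C_mul_egf, expSeries, expSeries, expSeries, egf_sub, egf_mul]
  congr 1
  funext n
  rw [oddSum]
  push_cast
  rw [Finset.mul_sum, Finset.mul_sum, Finset.sum_filter]
  refine Finset.sum_congr rfl fun j hj => ?_
  have hj' : j ≤ n := by simp at hj; omega
  have h3 : (θ : ℂ) ^ n = θ ^ j * θ ^ (n - j) := by rw [← pow_add]; congr 1; omega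
  rw [mul_pow _ Complex.I, mul_pow _ (-Complex.I), ← mul_sub, I_pow_sub_neg_I_pow, mul_pow,
    mul_pow, h3]
  split_ifs
  · ring
  · simp

lemma egf_indicator_zero : egf (fun n => if n = 0 then 1 else 0) = 1 := by
  ext n
  cases n <;> simp [egf, PowerSeries.coeff_one]

lemma evenSum_zero (r x : ℝ) : evenSum r x 0 = 1 := by
  simp [evenSum, Finset.sum_filter]

lemma oddSum_zero (r x : ℝ) : oddSum r x 0 = 0 := by
  simp [oddSum, Finset.sum_filter]

lemma GR_eval (x : ℝ) (k : ℕ) :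
    (k + 1) * (GR k).eval x = 1 / 2 * evenSum (2 : ℕ) x (k + 1) + 1 / 2 * evenSum 1 x (k + 1)
      + 0 * x ^ (k + 1) := by
  have hk : (k + 1 : ℝ) ≠ 0 := by positivity
  rw [zero_mul, add_zero, ← mul_add, GR, evenSum, evenSum, ← Finset.sum_add_distrib,
    Polynomial.eval_mul, Polynomial.eval_finsetSum, Polynomial.eval_C]
  simp only [Polynomial.eval_mul, Polynomial.eval_C, Polynomial.eval_pow, Polynomial.eval_X]
  field_simp
  exact Finset.sum_congr rfl fun j _ => by ring

lemma GP_eval (x : ℝ) (k : ℕ) :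
    (k + 1) * (GP k).eval x = 1 / 2 * evenSum (5 : ℕ) x (k + 1) + 1 / 2 * evenSum 1 x (k + 1)
      + 0 * x ^ (k + 1) := by
  have hk : (k + 1 : ℝ) ≠ 0 := by positivity
  rw [zero_mul, add_zero, ← mul_add, GP, evenSum, evenSum, ← Finset.sum_add_distrib,
    Polynomial.eval_mul, Polynomial.eval_finsetSum, Polynomial.eval_C]
  simp only [Polynomial.eval_mul, Polynomial.eval_C, Polynomial.eval_pow, Polynomial.eval_X]
  field_simp
  exact Finset.sum_congr rfl fun j _ => by ring

lemma GS_eval (x : ℝ) (k : ℕ) :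
    (k + 1) * (GS k).eval x = -1 / 2 * (oddSum (2 : ℕ) x (k + 1) - oddSum 1 x (k + 1)) := by
  have hk : (k + 1 : ℝ) ≠ 0 := by positivity
  rw [GS, oddSum, oddSum, ← Finset.sum_sub_distrib, Polynomial.eval_mul,
    Polynomial.eval_finsetSum, Polynomial.eval_C]
  simp only [Polynomial.eval_mul, Polynomial.eval_C, Polynomial.eval_pow, Polynomial.eval_X]
  field_simp
  rw [← Finset.sum_neg_distrib]
  refine Finset.sum_congr rfl fun j hj => ?_
  obtain ⟨r, rfl⟩ := (Finset.mem_filter.1 hj).2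
  have h1 : (2 * r + 1 - 1) / 2 = r := by omega
  have h2 : (2 * r + 1 + 1) / 2 = r + 1 := by omega
  rw [h1, h2, pow_succ]
  ring

lemma GQ_eval (x : ℝ) (k : ℕ) :
    (k + 1) * (GQ k).eval x = 1 / 2 * (oddSum (5 : ℕ) x (k + 1) - oddSum 1 x (k + 1)) := by
  have hk : (k + 1 : ℝ) ≠ 0 := by positivity
  rw [GQ, oddSum, oddSum, ← Finset.sum_sub_distrib, Polynomial.eval_mul,
    Polynomial.eval_finsetSum, Polynomial.eval_C]
  simp only [Polynomial.eval_mul, Polynomial.eval_C, Polynomial.eval_pow, Polynomial.eval_X]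
  field_simp
  exact Finset.sum_congr rfl fun j _ => by ring

lemma GY_eval (x : ℝ) (k : ℕ) :
    (k + 1) * (GY k).eval x = -1 * evenSum (3 : ℕ) x (k + 1) + 0 * evenSum 1 x (k + 1)
      + -1 * x ^ (k + 1) := by
  have hk : (k + 1 : ℝ) ≠ 0 := by positivity
  rw [GY, evenSum, Polynomial.eval_mul, Polynomial.eval_add,
    Polynomial.eval_finsetSum, Polynomial.eval_C]
  simp only [Polynomial.eval_mul, Polynomial.eval_C, Polynomial.eval_pow, Polynomial.eval_X]
  field_simp
  push_cast
  ring

lemma GZ_eval (x : ℝ) (k : ℕ) :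
    (k + 1) * (GZ k).eval x = -2 * evenSum (3 : ℕ) x (k + 1) + 0 * evenSum 1 x (k + 1)
      + 0 * x ^ (k + 1) := by
  have hk : (k + 1 : ℝ) ≠ 0 := by positivity
  rw [GZ, evenSum, Polynomial.eval_mul, Polynomial.eval_finsetSum, Polynomial.eval_C]
  simp only [Polynomial.eval_mul, Polynomial.eval_C, Polynomial.eval_pow, Polynomial.eval_X]
  field_simp
  push_cast
  ring

/-- A sequence vanishing at `0` and equal to `g n - c` elsewhere, where `g 0 = c`. -/
lemma egf_eval_eq (θ x c : ℝ) (G : ℕ → Polynomial ℝ) (g : ℕ → ℝ) (h0 : g 0 = c)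
    (h : ∀ k : ℕ, (k + 1) * (G k).eval x = g (k + 1)) :
    egf (fun n => ((θ ^ n * (n * (G (n - 1)).eval x) : ℝ) : ℂ))
      = egf (fun n => ((θ ^ n * g n : ℝ) : ℂ)) - PowerSeries.C (c : ℂ) := by
  rw [← mul_one (PowerSeries.C (c : ℂ)), ← egf_indicator_zero, C_mul_egf, egf_sub]
  congr 1
  funext n
  cases n with
  | zero => simp [h0]
  | succ k =>
    have := h k
    simp only [Nat.add_sub_cancel]
    push_cast [← this]
    simp

/-- `exp (i π X / 6)`. -/
noncomputable def unitSeries : PowerSeries ℂ := expSeries (Real.pi / 6 * Complex.I)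

/-- `exp (-i π X / 6)`. -/
noncomputable def unitSeriesInv : PowerSeries ℂ := expSeries (Real.pi / 6 * -Complex.I)

lemma unitSeries_mul_inv : unitSeries * unitSeriesInv = 1 := by
  rw [unitSeries, unitSeriesInv, ← expSeries_add, ← expSeries_zero]
  congr 1; ring

lemma expSeries_eq_unitSeries_pow (n : ℕ) {c : ℂ} (h : c = n * (Real.pi / 6 * Complex.I)) :
    expSeries c = unitSeries ^ n := by
  rw [h, expSeries_nat_mul, unitSeries]

lemma expSeries_eq_unitSeriesInv_pow (n : ℕ) {c : ℂ} (h : c = n * (Real.pi / 6 * -Complex.I)) :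
    expSeries c = unitSeriesInv ^ n := by
  rw [h, expSeries_nat_mul, unitSeriesInv]

/-- The generating function of `recFam` at `l / θ`, scaled by powers of `θ`. -/
noncomputable def recEgf (m θ l : ℝ) (G : ℕ → Polynomial ℝ) : PowerSeries ℂ :=
  egf (fun n => ((θ ^ (n + 1) * (recFam m G n).eval (l / θ) : ℝ) : ℂ))

lemma expSeries_angle (r d : ℕ) (θ : ℝ) (hθ : θ = d * (Real.pi / 6)) :
    expSeries ((r : ℝ) * θ * Complex.I) = unitSeries ^ (r * d) := by
  apply expSeries_eq_unitSeries_pow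
  rw [hθ]; push_cast; ring

lemma expSeries_neg_angle (r d : ℕ) (θ : ℝ) (hθ : θ = d * (Real.pi / 6)) :
    expSeries ((r : ℝ) * θ * -Complex.I) = unitSeriesInv ^ (r * d) := by
  apply expSeries_eq_unitSeriesInv_pow
  rw [hθ]; push_cast; ring

lemma egf_evenSum_angle (r d : ℕ) (hd : d ≠ 0) (θ : ℝ) (hθ : θ = d * (Real.pi / 6)) (l : ℝ) :
    PowerSeries.C 2 * egf (fun n => ((θ ^ n * evenSum r (l / θ) n : ℝ) : ℂ))
      = (unitSeries ^ (r * d) + unitSeriesInv ^ (r * d)) * expSeries l := by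
  have h0 : θ ≠ 0 := by rw [hθ]; have := Real.pi_pos; positivity
  rw [egf_evenSum, expSeries_angle r d θ hθ, expSeries_neg_angle r d θ hθ, ← Complex.ofReal_mul,
    mul_div_cancel₀ _ h0]

lemma egf_oddSum_angle (r d : ℕ) (hd : d ≠ 0) (θ : ℝ) (hθ : θ = d * (Real.pi / 6)) (l : ℝ) :
    PowerSeries.C (2 * Complex.I) * egf (fun n => ((θ ^ n * oddSum r (l / θ) n : ℝ) : ℂ))
      = (unitSeries ^ (r * d) - unitSeriesInv ^ (r * d)) * expSeries l := by
  have h0 : θ ≠ 0 := by rw [hθ]; have := Real.pi_pos; positivity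
  rw [egf_oddSum, expSeries_angle r d θ hθ, expSeries_neg_angle r d θ hθ, ← Complex.ofReal_mul,
    mul_div_cancel₀ _ h0]

lemma recEgf_mul_of_even (m r d : ℕ) (hd : d ≠ 0) (θ : ℝ) (hθ : θ = d * (Real.pi / 6)) (l : ℝ)
    (α β γ : ℝ) (G : ℕ → Polynomial ℝ)
    (hG : ∀ (x : ℝ) (k : ℕ), (k + 1) * (G k).eval x
      = α * evenSum r x (k + 1) + β * evenSum 1 x (k + 1) + γ * x ^ (k + 1)) :
    recEgf m θ l G * (unitSeries ^ (m * d) - unitSeriesInv ^ (m * d))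
      = PowerSeries.C (Complex.I * m * θ) *
        ((PowerSeries.C (α : ℂ) * (unitSeries ^ (r * d) + unitSeriesInv ^ (r * d))
          + PowerSeries.C (β : ℂ) * (unitSeries ^ d + unitSeriesInv ^ d)
          + PowerSeries.C (γ : ℂ) * 2) * expSeries l
          - 2 * PowerSeries.C ((α + β + γ : ℝ) : ℂ)) := by
  have h0 : θ ≠ 0 := by rw [hθ]; have := Real.pi_pos; positivity
  have h := egf_recFam_mul m θ G (l / θ)
  rw [egf_eval_eq _ _ (α + β + γ) _
    (fun n => α * evenSum r (l / θ) n + β * evenSum 1 (l / θ) n + γ * (l / θ) ^ n)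
    (by simp [evenSum_zero]) (hG _), expSeries_angle m d θ hθ, expSeries_neg_angle m d θ hθ] at h
  have e2 := egf_evenSum_angle r d hd θ hθ l
  have e1 := egf_evenSum_angle 1 d hd θ hθ l
  rw [one_mul, Nat.cast_one] at e1
  have hsum : PowerSeries.C 2 * egf (fun n => ((θ ^ n * (α * evenSum r (l / θ) n
      + β * evenSum 1 (l / θ) n + γ * (l / θ) ^ n) : ℝ) : ℂ))
      = PowerSeries.C (α : ℂ) *
          (PowerSeries.C 2 * egf (fun n => ((θ ^ n * evenSum r (l / θ) n : ℝ) : ℂ)))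
        + PowerSeries.C (β : ℂ) *
          (PowerSeries.C 2 * egf (fun n => ((θ ^ n * evenSum 1 (l / θ) n : ℝ) : ℂ)))
        + PowerSeries.C (γ : ℂ) * (PowerSeries.C 2 * expSeries l) := by
    simp only [C_mul_egf, egf_add, expSeries]
    congr 1
    funext n
    have : (l : ℂ) ^ n = (θ : ℂ) ^ n * (l / θ : ℂ) ^ n := by
      rw [← mul_pow, mul_div_cancel₀]
      exact_mod_cast h0
    push_cast
    rw [this]
    ring
  rw [e1, e2] at hsum
  have h2 : (PowerSeries.C 2 : PowerSeries ℂ) = 2 := map_ofNat _ 2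
  have hI : (PowerSeries.C (2 * Complex.I * (m : ℝ) * θ) : PowerSeries ℂ)
      = 2 * PowerSeries.C (Complex.I * m * θ) := by
    rw [← h2, ← map_mul]; congr 1; push_cast; ring
  rw [hI] at h
  rw [h2] at hsum
  rw [recEgf, h]
  linear_combination PowerSeries.C (Complex.I * m * θ) * hsum

lemma recEgf_mul_of_odd (m r d : ℕ) (hd : d ≠ 0) (θ : ℝ) (hθ : θ = d * (Real.pi / 6)) (l : ℝ)
    (α : ℝ) (G : ℕ → Polynomial ℝ)
    (hG : ∀ (x : ℝ) (k : ℕ), (k + 1) * (G k).eval x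
      = α * (oddSum r x (k + 1) - oddSum 1 x (k + 1))) :
    recEgf m θ l G * (unitSeries ^ (m * d) - unitSeriesInv ^ (m * d))
      = PowerSeries.C (m * θ * α : ℂ) *
        ((unitSeries ^ (r * d) - unitSeriesInv ^ (r * d)) - (unitSeries ^ d - unitSeriesInv ^ d))
          * expSeries l := by
  have h := egf_recFam_mul m θ G (l / θ)
  rw [egf_eval_eq _ _ 0 _
    (fun n => α * (oddSum r (l / θ) n - oddSum 1 (l / θ) n))
    (by simp [oddSum_zero]) (hG _), expSeries_angle m d θ hθ, expSeries_neg_angle m d θ hθ] at h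
  have e2 := egf_oddSum_angle r d hd θ hθ l
  have e1 := egf_oddSum_angle 1 d hd θ hθ l
  rw [one_mul, Nat.cast_one] at e1
  have hsum : PowerSeries.C (2 * Complex.I * (m : ℝ) * θ) * egf (fun n =>
      ((θ ^ n * (α * (oddSum r (l / θ) n - oddSum 1 (l / θ) n)) : ℝ) : ℂ))
      = PowerSeries.C (m * θ * α : ℂ) * (PowerSeries.C (2 * Complex.I) *
          egf (fun n => ((θ ^ n * oddSum r (l / θ) n : ℝ) : ℂ))
        - PowerSeries.C (2 * Complex.I) *
          egf (fun n => ((θ ^ n * oddSum 1 (l / θ) n : ℝ) : ℂ))) := by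
    simp only [C_mul_egf, egf_sub]
    congr 1
    funext n
    push_cast
    ring
  rw [recEgf, h, Complex.ofReal_zero, map_zero, sub_zero, hsum, e1, e2]
  ring

lemma C_half : (PowerSeries.C ((1 / 2 : ℝ) : ℂ) : PowerSeries ℂ) * 2 = 1 := by
  rw [← map_ofNat PowerSeries.C 2, ← map_mul]; norm_num

lemma recEgf_GR_add_GP (l : ℝ) :
    (recEgf 3 (2 * Real.pi / 3) l GR + recEgf 6 (Real.pi / 3) l GP) *
        (unitSeries ^ 12 - unitSeriesInv ^ 12)
      = PowerSeries.C (Complex.I * Real.pi) *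
        ((unitSeries ^ 8 + unitSeriesInv ^ 8 + unitSeries ^ 4 + unitSeriesInv ^ 4
          + unitSeries ^ 10 + unitSeriesInv ^ 10 + unitSeries ^ 2 + unitSeriesInv ^ 2)
          * expSeries l - 8) := by
  have hR := recEgf_mul_of_even 3 2 4 (by norm_num) (2 * Real.pi / 3) (by push_cast; ring) l
    (1 / 2) (1 / 2) 0 GR GR_eval
  have hP := recEgf_mul_of_even 6 5 2 (by norm_num) (Real.pi / 3) (by push_cast; ring) l
    (1 / 2) (1 / 2) 0 GP GP_eval
  have c1 : (PowerSeries.C (Complex.I * (3 : ℕ) * (2 * Real.pi / 3 : ℝ)) : PowerSeries ℂ)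
      = 2 * PowerSeries.C (Complex.I * Real.pi) := by
    rw [← map_ofNat PowerSeries.C 2, ← map_mul]; congr 1; push_cast; ring
  have c2 : (PowerSeries.C (Complex.I * (6 : ℕ) * (Real.pi / 3 : ℝ)) : PowerSeries ℂ)
      = 2 * PowerSeries.C (Complex.I * Real.pi) := by
    rw [← map_ofNat PowerSeries.C 2, ← map_mul]; congr 1; push_cast; ring
  rw [c1] at hR
  rw [c2] at hP
  have c3 : (PowerSeries.C ((1 / 2 + 1 / 2 + 0 : ℝ) : ℂ) : PowerSeries ℂ) = 1 := by norm_num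
  rw [c3, Complex.ofReal_zero, map_zero] at hR hP
  norm_num only at hR hP
  rw [add_mul, hR, hP]
  have ch := C_half
  norm_num only at ch
  linear_combination (PowerSeries.C (Complex.I * Real.pi) *
    ((unitSeries ^ 8 + unitSeriesInv ^ 8 + unitSeries ^ 4 + unitSeriesInv ^ 4
          + unitSeries ^ 10 + unitSeriesInv ^ 10 + unitSeries ^ 2 + unitSeriesInv ^ 2)
          * expSeries l)) * ch

lemma recEgf_GY_add_GZ (l : ℝ) :
    (recEgf 3 (2 * Real.pi / 3) l GY + recEgf 6 (Real.pi / 3) l GZ) *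
        (unitSeries ^ 12 - unitSeriesInv ^ 12)
      = PowerSeries.C (Complex.I * Real.pi) *
        (-(2 * unitSeries ^ 12 + 2 * unitSeriesInv ^ 12 + 4 * unitSeries ^ 6
          + 4 * unitSeriesInv ^ 6 + 4) * expSeries l + 16) := by
  have hR := recEgf_mul_of_even 3 3 4 (by norm_num) (2 * Real.pi / 3) (by push_cast; ring) l
    (-1) 0 (-1) GY GY_eval
  have hP := recEgf_mul_of_even 6 3 2 (by norm_num) (Real.pi / 3) (by push_cast; ring) l
    (-2) 0 0 GZ GZ_eval
  have c1 : (PowerSeries.C (Complex.I * (3 : ℕ) * (2 * Real.pi / 3 : ℝ)) : PowerSeries ℂ)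
      = 2 * PowerSeries.C (Complex.I * Real.pi) := by
    rw [← map_ofNat PowerSeries.C 2, ← map_mul]; congr 1; push_cast; ring
  have c2 : (PowerSeries.C (Complex.I * (6 : ℕ) * (Real.pi / 3 : ℝ)) : PowerSeries ℂ)
      = 2 * PowerSeries.C (Complex.I * Real.pi) := by
    rw [← map_ofNat PowerSeries.C 2, ← map_mul]; congr 1; push_cast; ring
  rw [c1] at hR
  rw [c2] at hP
  have c3 : (PowerSeries.C ((-1 + 0 + -1 : ℝ) : ℂ) : PowerSeries ℂ) = -2 := by
    rw [← map_ofNat PowerSeries.C 2, ← map_neg]; norm_num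
  have c4 : (PowerSeries.C ((-2 + 0 + 0 : ℝ) : ℂ) : PowerSeries ℂ) = -2 := by
    rw [← map_ofNat PowerSeries.C 2, ← map_neg]; norm_num
  have c5 : (PowerSeries.C ((-2 : ℝ) : ℂ) : PowerSeries ℂ) = -2 := by
    rw [← map_ofNat PowerSeries.C 2, ← map_neg]; norm_num
  have c6 : (PowerSeries.C ((-1 : ℝ) : ℂ) : PowerSeries ℂ) = -1 := by
    rw [Complex.ofReal_neg, map_neg, Complex.ofReal_one, map_one]
  rw [c3, c6, Complex.ofReal_zero, map_zero] at hR
  rw [c4, c5, Complex.ofReal_zero, map_zero] at hP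
  norm_num only at hR hP
  rw [add_mul, hR, hP]
  ring

lemma recEgf_GS_add_GQ (l : ℝ) :
    (recEgf 3 (2 * Real.pi / 3) l GS + recEgf 6 (Real.pi / 3) l GQ) *
        (unitSeries ^ 12 - unitSeriesInv ^ 12)
      = PowerSeries.C (Real.pi : ℂ) *
        ((unitSeries ^ 10 - unitSeriesInv ^ 10) - (unitSeries ^ 2 - unitSeriesInv ^ 2)
          - (unitSeries ^ 8 - unitSeriesInv ^ 8) + (unitSeries ^ 4 - unitSeriesInv ^ 4))
          * expSeries l := by
  have hR := recEgf_mul_of_odd 3 2 4 (by norm_num) (2 * Real.pi / 3) (by push_cast; ring) l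
    (-1 / 2) GS GS_eval
  have hP := recEgf_mul_of_odd 6 5 2 (by norm_num) (Real.pi / 3) (by push_cast; ring) l
    (1 / 2) GQ GQ_eval
  have c1 : (PowerSeries.C ((3 : ℕ) * (2 * Real.pi / 3 : ℝ) * ((-1 / 2 : ℝ) : ℂ)) : PowerSeries ℂ)
      = - PowerSeries.C (Real.pi : ℂ) := by
    rw [← map_neg]; congr 1; push_cast; ring
  have c2 : (PowerSeries.C ((6 : ℕ) * (Real.pi / 3 : ℝ) * ((1 / 2 : ℝ) : ℂ)) : PowerSeries ℂ)
      = PowerSeries.C (Real.pi : ℂ) := by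
    congr 1; push_cast; ring
  rw [c1] at hR
  rw [c2] at hP
  norm_num only at hR hP
  rw [add_mul, hR, hP]
  ring

/-- `bernSum` at `c = i π`. -/
noncomputable def bernPlus (τ l : ℝ) : ℕ → ℂ := bernSum (Real.pi * Complex.I) τ l

/-- `bernSum` at `c = - i π`. -/
noncomputable def bernMinus (τ l : ℝ) : ℕ → ℂ := bernSum (Real.pi * -Complex.I) τ l

lemma egf_bernPlus_mul (τ l : ℝ) (n : ℕ) (hτ : 6 * τ = n) :
    egf (bernPlus τ l) * (unitSeries ^ 6 - 1)
      = PowerSeries.X * PowerSeries.C (Complex.I * Real.pi) * unitSeries ^ n * expSeries l := by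
  have h := egf_bernSum_mul (Real.pi * Complex.I) τ l
  have hτ' : 6 * (τ : ℂ) = n := by exact_mod_cast hτ
  rw [expSeries_eq_unitSeries_pow 6 (by push_cast; ring),
    expSeries_eq_unitSeries_pow n (by rw [← hτ']; ring), mul_comm (Real.pi : ℂ)] at h
  rw [bernPlus, mul_comm (Real.pi : ℂ), h]

lemma egf_bernMinus_mul (τ l : ℝ) (n : ℕ) (hτ : 6 * τ = n) (hn : n ≤ 6) :
    egf (bernMinus τ l) * (unitSeries ^ 6 - 1)
      = PowerSeries.X * PowerSeries.C (Complex.I * Real.pi) * unitSeries ^ (6 - n)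
        * expSeries l := by
  have h := egf_bernSum_mul (Real.pi * -Complex.I) τ l
  have hτ' : 6 * (τ : ℂ) = n := by exact_mod_cast hτ
  have hC : (PowerSeries.C (Real.pi * -Complex.I) : PowerSeries ℂ)
      = - PowerSeries.C (Complex.I * Real.pi) := by rw [← map_neg]; congr 1; ring
  have h1 : unitSeries ^ 6 * unitSeriesInv ^ n = unitSeries ^ (6 - n) := by
    rw [← Nat.sub_add_cancel hn, pow_add, mul_assoc, ← mul_pow, unitSeries_mul_inv]
    simp
  have h2 : unitSeries ^ 6 * unitSeriesInv ^ 6 = 1 := by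
    rw [← mul_pow, unitSeries_mul_inv, one_pow]
  rw [expSeries_eq_unitSeriesInv_pow 6 (by push_cast; ring), hC,
    expSeries_eq_unitSeriesInv_pow n (by rw [← hτ']; ring)] at h
  rw [bernMinus, ← h1]
  linear_combination (-unitSeries ^ 6) * h + egf (bernSum (Real.pi * -Complex.I) τ l) * h2

lemma unitSeries_pow_sub_one_ne_zero : unitSeries ^ 24 - 1 ≠ 0 := by
  rw [unitSeries, ← expSeries_nat_mul]
  apply expSeries_sub_one_ne_zero
  have := Real.pi_pos.ne'
  simp [this]

lemma combination_even (la lb : ℝ) (k : ℕ) :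
    ((k + 1 : ℝ) * ((2 * Real.pi / 3) ^ (k + 1) *
          (-(Rpoly k).eval (la / (2 * Real.pi / 3)) + 3 * (Rpoly k).eval (lb / (2 * Real.pi / 3))
            + (Ypoly k).eval (la / (2 * Real.pi / 3)))
        + (Real.pi / 3) ^ (k + 1) *
          (-(Ppoly k).eval (la / (Real.pi / 3)) + 3 * (Ppoly k).eval (lb / (Real.pi / 3))
            + (Zpoly k).eval (la / (Real.pi / 3)))) : ℝ)
      = -(bernPlus (1 / 3) la (k + 1) + bernMinus (1 / 3) la (k + 1))
        + 3 * (bernPlus (1 / 3) lb (k + 1) + bernMinus (1 / 3) lb (k + 1))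
        - 2 * (bernPlus 0 la (k + 1) + bernMinus 0 la (k + 1)) := by
  have p1 := egf_bernPlus_mul (1 / 3) la 2 (by norm_num)
  have p2 := egf_bernPlus_mul (1 / 3) lb 2 (by norm_num)
  have p3 := egf_bernPlus_mul 0 la 0 (by norm_num)
  have m1 := egf_bernMinus_mul (1 / 3) la 2 (by norm_num) (by norm_num)
  have m2 := egf_bernMinus_mul (1 / 3) lb 2 (by norm_num) (by norm_num)
  have m3 := egf_bernMinus_mul 0 la 0 (by norm_num) (by norm_num)
  norm_num only at m1 m2 m3
  have huv : ∀ n, unitSeries ^ n * unitSeriesInv ^ n = 1 := fun n => by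
    rw [← mul_pow, unitSeries_mul_inv, one_pow]
  have hR (l : ℝ) : (recEgf 3 (2 * Real.pi / 3) l GR + recEgf 6 (Real.pi / 3) l GP) *
        (unitSeries ^ 24 - 1) = PowerSeries.C (Complex.I * Real.pi) *
        ((unitSeries ^ 20 + unitSeries ^ 4 + unitSeries ^ 16 + unitSeries ^ 8 + unitSeries ^ 22
          + unitSeries ^ 2 + unitSeries ^ 14 + unitSeries ^ 10) * expSeries l
          - 8 * unitSeries ^ 12) := by
    linear_combination unitSeries ^ 12 * recEgf_GR_add_GP l +
      (recEgf 3 (2 * Real.pi / 3) l GR + recEgf 6 (Real.pi / 3) l GP) * huv 12 +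
      PowerSeries.C (Complex.I * Real.pi) * expSeries l * (unitSeries ^ 2 * huv 10
        + unitSeries ^ 10 * huv 2 + unitSeries ^ 4 * huv 8 + unitSeries ^ 8 * huv 4)
  have hY' : (recEgf 3 (2 * Real.pi / 3) la GY + recEgf 6 (Real.pi / 3) la GZ) *
        (unitSeries ^ 24 - 1) = PowerSeries.C (Complex.I * Real.pi) *
        (-(2 * unitSeries ^ 24 + 2 + 4 * unitSeries ^ 18 + 4 * unitSeries ^ 6
          + 4 * unitSeries ^ 12) * expSeries la + 16 * unitSeries ^ 12) := by
    linear_combination unitSeries ^ 12 * recEgf_GY_add_GZ la +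
      (recEgf 3 (2 * Real.pi / 3) la GY + recEgf 6 (Real.pi / 3) la GZ) * huv 12 -
      PowerSeries.C (Complex.I * Real.pi) * expSeries la * (2 * huv 12 + 4 * unitSeries ^ 6 * huv 6)
  have key : PowerSeries.X *
      (-(recEgf 3 (2 * Real.pi / 3) la GR + recEgf 6 (Real.pi / 3) la GP)
        + PowerSeries.C 3 * (recEgf 3 (2 * Real.pi / 3) lb GR + recEgf 6 (Real.pi / 3) lb GP)
        + (recEgf 3 (2 * Real.pi / 3) la GY + recEgf 6 (Real.pi / 3) la GZ))
      = -(egf (bernPlus (1 / 3) la) + egf (bernMinus (1 / 3) la))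
        + PowerSeries.C 3 * (egf (bernPlus (1 / 3) lb) + egf (bernMinus (1 / 3) lb))
        - PowerSeries.C 2 * (egf (bernPlus 0 la) + egf (bernMinus 0 la)) := by
    refine mul_right_cancel₀ unitSeries_pow_sub_one_ne_zero ?_
    have c3 : (PowerSeries.C 3 : PowerSeries ℂ) = 3 := map_ofNat _ 3
    have c2 : (PowerSeries.C 2 : PowerSeries ℂ) = 2 := map_ofNat _ 2
    rw [c2, c3]
    linear_combination PowerSeries.X * (-hR la + 3 * hR lb + hY') +
      (unitSeries ^ 18 + unitSeries ^ 12 + unitSeries ^ 6 + 1) *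
        (p1 + m1 - 3 * (p2 + m2) + 2 * (p3 + m3))
  simp only [recEgf, egf_add, C_mul_egf] at key
  rw [← neg_one_mul (egf _), ← neg_one_mul (egf _), ← map_one PowerSeries.C, ← map_neg] at key
  simp only [egf_add, X_mul_egf, egf_sub, C_mul_egf] at key
  have := egf_injective key (k + 1)
  simp only [Nat.add_sub_cancel] at this
  rw [← sub_eq_zero]
  rw [← sub_eq_zero] at this
  rw [← this]
  simp only [Rpoly, Ppoly, Ypoly, Zpoly]
  push_cast
  ring

lemma combination_odd (l : ℝ) (k : ℕ) :
    ((k + 1 : ℝ) * ((2 * Real.pi / 3) ^ (k + 1) * (Spoly k).eval (l / (2 * Real.pi / 3))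
        + (Real.pi / 3) ^ (k + 1) * (Qpoly k).eval (l / (Real.pi / 3))) : ℝ)
      = Complex.I * (bernPlus (1 / 3) l (k + 1) - bernMinus (1 / 3) l (k + 1)) := by
  have hS := recEgf_GS_add_GQ l
  have p1 := egf_bernPlus_mul (1 / 3) l 2 (by norm_num)
  have m1 := egf_bernMinus_mul (1 / 3) l 2 (by norm_num) (by norm_num)
  norm_num only at m1
  have huv : ∀ n, unitSeries ^ n * unitSeriesInv ^ n = 1 := fun n => by
    rw [← mul_pow, unitSeries_mul_inv, one_pow]
  have hS' : (recEgf 3 (2 * Real.pi / 3) l GS + recEgf 6 (Real.pi / 3) l GQ) *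
        (unitSeries ^ 24 - 1) = PowerSeries.C (Real.pi : ℂ) *
        (unitSeries ^ 22 - unitSeries ^ 2 - unitSeries ^ 14 + unitSeries ^ 10
          - unitSeries ^ 20 + unitSeries ^ 4 + unitSeries ^ 16 - unitSeries ^ 8)
          * expSeries l := by
    linear_combination unitSeries ^ 12 * hS +
      (recEgf 3 (2 * Real.pi / 3) l GS + recEgf 6 (Real.pi / 3) l GQ) * huv 12 -
      PowerSeries.C (Real.pi : ℂ) * expSeries l * (unitSeries ^ 2 * huv 10
        - unitSeries ^ 10 * huv 2 - unitSeries ^ 4 * huv 8 + unitSeries ^ 8 * huv 4)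
  have key : PowerSeries.X *
      (recEgf 3 (2 * Real.pi / 3) l GS + recEgf 6 (Real.pi / 3) l GQ)
      = PowerSeries.C Complex.I * (egf (bernPlus (1 / 3) l) - egf (bernMinus (1 / 3) l)) := by
    refine mul_right_cancel₀ unitSeries_pow_sub_one_ne_zero ?_
    have hC : (PowerSeries.C Complex.I : PowerSeries ℂ) * PowerSeries.C (Complex.I * Real.pi)
      = - PowerSeries.C (Real.pi : ℂ) := by
      rw [← map_mul, ← map_neg, ← mul_assoc, Complex.I_mul_I]; simp
    linear_combination PowerSeries.X * hS' - PowerSeries.C Complex.I *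
      (unitSeries ^ 18 + unitSeries ^ 12 + unitSeries ^ 6 + 1) * (p1 - m1)
      - (unitSeries ^ 18 + unitSeries ^ 12 + unitSeries ^ 6 + 1) * (unitSeries ^ 2 - unitSeries ^ 4)
        * PowerSeries.X * expSeries l * hC
  simp only [recEgf, egf_add, X_mul_egf, egf_sub, C_mul_egf] at key
  have := egf_injective key (k + 1)
  rw [← this]
  simp only [Nat.add_sub_cancel, Spoly, Qpoly]
  push_cast
  ring

open Set

lemma integral_pow_mul_exp_neg (j : ℕ) {r : ℝ} (hr : 0 < r) :
    ∫ x in Ioi (0 : ℝ), x ^ j * Real.exp (-(r * x)) = j.factorial / r ^ (j + 1) := by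
  have h := Real.integral_rpow_mul_exp_neg_mul_Ioi (a := j + 1) (by positivity) hr
  simp only [add_sub_cancel_right, Real.rpow_natCast] at h
  rw [h, Real.Gamma_nat_eq_factorial, ← Nat.cast_succ, Real.rpow_natCast, one_div, inv_pow,
    div_eq_inv_mul]

lemma integrableOn_pow_mul_exp_neg (j : ℕ) {r : ℝ} (hr : 0 < r) :
    IntegrableOn (fun x : ℝ => x ^ j * Real.exp (-(r * x))) (Ioi 0) := by
  refine .of_integral_ne_zero ?_
  rw [integral_pow_mul_exp_neg j hr]
  positivity

lemma integrable_pow_mul_exp_neg_abs (j : ℕ) :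
    Integrable fun x : ℝ => |x| ^ j * Real.exp (-|x|) := by
  have h1 : IntegrableOn (fun x : ℝ => |x| ^ j * Real.exp (-|x|)) (Ioi 0) := by
    refine (integrableOn_pow_mul_exp_neg j one_pos).congr_fun (fun x hx => ?_) measurableSet_Ioi
    simp only [abs_of_pos (mem_Ioi.1 hx), one_mul]
  have h2 : IntegrableOn (fun x : ℝ => |x| ^ j * Real.exp (-|x|)) (Iio 0) := by
    have h3 := h1.comp_neg
    simpa [abs_neg] using h3
  rw [← integrableOn_univ, ← Iic_union_Ioi (a := (0 : ℝ))]
  exact ((integrableOn_Iic_iff_integrableOn_Iio).2 h2).union h1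

/-- Term-by-term integration of an exponential series against `x ^ j`. -/
lemma hasSum_integral_pow_mul (c : ℕ → ℝ) (hc : ∀ n, |c n| ≤ 1) (g : ℝ → ℝ)
    (hg : ∀ x : ℝ, 0 < x → HasSum (fun n : ℕ => c n * Real.exp (-(2 * (n + 1) * x))) (g x))
    {j : ℕ} (hj : j ≠ 0) :
    HasSum (fun n : ℕ => c n * (j.factorial / (2 * (n + 1)) ^ (j + 1)))
      (∫ x in Ioi (0 : ℝ), x ^ j * g x) := by
  have hr (n : ℕ) : (0 : ℝ) < 2 * (n + 1) := by positivity
  have hint (n : ℕ) := integrableOn_pow_mul_exp_neg j (hr n)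
  have hF (n : ℕ) : Integrable (fun x : ℝ => c n * (x ^ j * Real.exp (-(2 * (n + 1) * x))))
      (volume.restrict (Ioi 0)) := (hint n).const_mul _
  have hnorm (n : ℕ) : ∫ x in Ioi (0 : ℝ), ‖c n * (x ^ j * Real.exp (-(2 * (n + 1) * x)))‖
      = |c n| * (j.factorial / (2 * (n + 1)) ^ (j + 1)) := by
    rw [← integral_pow_mul_exp_neg j (hr n), ← integral_const_mul]
    refine setIntegral_congr_fun measurableSet_Ioi fun x hx => ?_
    have hx' : (0 : ℝ) < x := hx
    simp only [norm_mul, Real.norm_eq_abs, Real.abs_exp, abs_pow, abs_of_pos hx']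
  have hsum : Summable fun n : ℕ =>
      ∫ x in Ioi (0 : ℝ), ‖c n * (x ^ j * Real.exp (-(2 * (n + 1) * x)))‖ := by
    simp only [hnorm]
    have h1 : Summable fun n : ℕ => (j.factorial : ℝ) * (1 / ((n + 1 : ℕ) : ℝ) ^ (j + 1)) :=
      ((summable_nat_add_iff 1).2
        (Real.summable_one_div_nat_pow.2 (by omega : 1 < j + 1))).mul_left _
    refine Summable.of_nonneg_of_le (fun n => by positivity) (fun n => ?_) h1
    have h2 : (j.factorial : ℝ) / (2 * (n + 1)) ^ (j + 1)
        ≤ j.factorial * (1 / ((n + 1 : ℕ) : ℝ) ^ (j + 1)) := by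
      rw [mul_one_div]
      push_cast
      gcongr
      linarith [(Nat.cast_nonneg n : (0 : ℝ) ≤ n)]
    refine le_trans ?_ h2
    exact mul_le_of_le_one_left (by positivity) (hc n)
  have h := hasSum_integral_of_summable_integral_norm hF hsum
  simp only [integral_const_mul, integral_pow_mul_exp_neg j (hr _)] at h
  convert! h using 1
  refine setIntegral_congr_fun measurableSet_Ioi fun x hx => ?_
  have h3 := ((hg x hx).mul_left (x ^ j)).tsum_eq
  rw [← h3]
  exact tsum_congr fun n => by ring

lemma hasSum_geometric_polar {x : ℝ} (hx : 0 < x) (φ : ℝ) :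
    HasSum (fun n : ℕ => Real.cos ((n + 1) * φ) * Real.exp (-(2 * (n + 1) * x)))
      ((Real.exp (-(2 * x)) * Real.cos φ - Real.exp (-(2 * x)) ^ 2)
        / (1 - 2 * Real.exp (-(2 * x)) * Real.cos φ + Real.exp (-(2 * x)) ^ 2)) ∧
    HasSum (fun n : ℕ => Real.sin ((n + 1) * φ) * Real.exp (-(2 * (n + 1) * x)))
      ((Real.exp (-(2 * x)) * Real.sin φ)
        / (1 - 2 * Real.exp (-(2 * x)) * Real.cos φ + Real.exp (-(2 * x)) ^ 2)) := by
  set r := Real.exp (-(2 * x)) with hr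
  have hr0 : 0 < r := Real.exp_pos _
  have hr1 : r < 1 := by rw [hr, Real.exp_lt_one_iff]; linarith
  set z : ℂ := Complex.exp ((-(2 * x) : ℝ) + φ * Complex.I) with hz
  have hzn : ‖z‖ < 1 := by
    rw [hz, Complex.norm_exp]; simpa [← hr] using hr1
  have hzre : z.re = r * Real.cos φ := by rw [hz, Complex.exp_re]; simp [hr]
  have hzim : z.im = r * Real.sin φ := by rw [hz, Complex.exp_im]; simp [hr]
  have h := (hasSum_geometric_of_norm_lt_one hzn).mul_left z
  have hD : 0 < 1 - 2 * r * Real.cos φ + r ^ 2 := by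
    nlinarith [Real.cos_le_one φ, mul_pos hr0 (sub_pos.2 hr1), sq_nonneg (1 - r)]
  have hz1 : (1 - z) ≠ 0 := by
    intro h0
    rw [sub_eq_zero] at h0
    rw [← h0] at hzn
    simp at hzn
  have hterm (n : ℕ) : z * z ^ n
      = (Real.exp (-(2 * (n + 1) * x)) : ℂ) * Complex.exp (((n + 1) * φ : ℝ) * Complex.I) := by
    rw [← pow_succ', hz, ← Complex.exp_nat_mul, Complex.ofReal_exp, ← Complex.exp_add]
    congr 1
    push_cast
    ring
  have hcs := Real.cos_sq_add_sin_sq φ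
  have hval : z * (1 - z)⁻¹
      = (((r * Real.cos φ - r ^ 2) / (1 - 2 * r * Real.cos φ + r ^ 2) : ℝ) : ℂ)
        + (((r * Real.sin φ) / (1 - 2 * r * Real.cos φ + r ^ 2) : ℝ) : ℂ) * Complex.I := by
    rw [← div_eq_mul_inv, div_eq_iff hz1]
    obtain ⟨A, hA⟩ : ∃ A, A = (r * Real.cos φ - r ^ 2) / (1 - 2 * r * Real.cos φ + r ^ 2) :=
      ⟨_, rfl⟩
    obtain ⟨B, hB⟩ : ∃ B, B = (r * Real.sin φ) / (1 - 2 * r * Real.cos φ + r ^ 2) := ⟨_, rfl⟩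
    rw [← hA, ← hB]
    rw [eq_div_iff hD.ne'] at hA hB
    apply Complex.ext
    · simp only [hzre, hzim, Complex.add_re, Complex.mul_re, Complex.sub_re, Complex.one_re,
        Complex.sub_im, Complex.one_im, Complex.ofReal_re, Complex.ofReal_im, Complex.I_re,
        Complex.I_im, Complex.add_im, Complex.mul_im]
      refine mul_right_cancel₀ hD.ne' ?_
      linear_combination (-(1 - r * Real.cos φ)) * hA - r * Real.sin φ * hB +
        (- r ^ 2) * hcs
    · simp only [hzre, hzim, Complex.add_re, Complex.mul_re, Complex.sub_re, Complex.one_re,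
        Complex.sub_im, Complex.one_im, Complex.ofReal_re, Complex.ofReal_im, Complex.I_re,
        Complex.I_im, Complex.add_im, Complex.mul_im]
      refine mul_right_cancel₀ hD.ne' ?_
      linear_combination (-(1 - r * Real.cos φ)) * hB + r * Real.sin φ * hA
  rw [hval] at h
  simp only [hterm] at h
  constructor
  · convert! Complex.hasSum_re h using 1
    · funext n
      rw [Complex.re_ofReal_mul, Complex.exp_ofReal_mul_I_re, mul_comm]
    · simp only [Complex.add_re, Complex.ofReal_re, Complex.re_ofReal_mul, Complex.I_re, mul_zero,
        add_zero]
  · convert! Complex.hasSum_im h using 1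
    · funext n
      rw [Complex.im_ofReal_mul, Complex.exp_ofReal_mul_I_im, mul_comm]
    · simp only [Complex.add_im, Complex.ofReal_im, Complex.im_ofReal_mul, Complex.I_im, mul_one,
        zero_add]

lemma hasSum_fourier_bernoulli {m : ℕ} (hm : 2 ≤ m) {τ : ℝ} (hτ : τ ∈ Icc (0 : ℝ) 1) :
    HasSum (fun n : ℕ => (1 : ℂ) / ((n : ℂ) + 1) ^ m *
        (Complex.exp (((n + 1) * (2 * Real.pi * τ) : ℝ) * Complex.I)
          + (-1) ^ m * Complex.exp (-((n + 1) * (2 * Real.pi * τ) : ℝ) * Complex.I)))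
      (-(2 * Real.pi * Complex.I) ^ m / m.factorial
        * Polynomial.aeval (τ : ℂ) (Polynomial.bernoulli m)) := by
  have h := hasSum_one_div_nat_pow_mul_fourier hm hτ
  have hB : ((bernoulliFun m τ : ℝ) : ℂ) = Polynomial.aeval (τ : ℂ) (Polynomial.bernoulli m) := by
    rw [bernoulliFun, Polynomial.eval_map_algebraMap, ← Complex.coe_algebraMap,
      Polynomial.aeval_algebraMap_apply]
  rw [hB, ← hasSum_nat_add_iff' 1] at h
  simp only [sum_range_one, Nat.cast_zero, zero_pow (by omega : m ≠ 0), div_zero, zero_mul,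
    sub_zero] at h
  convert! h using 1
  funext n
  rw [fourier_coe_apply, fourier_coe_apply]
  push_cast
  congr 3
  · ring
  · congr 1
    ring

lemma integral_pow_mul_eq_zero {f : ℝ → ℝ} {j : ℕ} (hf : ∀ x, (-x) ^ j * f (-x) = -(x ^ j * f x)) :
    ∫ x, x ^ j * f x = 0 := by
  have h := integral_neg_eq_self (fun x : ℝ => x ^ j * f x) volume
  simp only [hf, integral_neg] at h
  linarith

lemma integral_pow_mul_eq_two_mul {f : ℝ → ℝ} {j : ℕ}
    (hf : ∀ x, (-x) ^ j * f (-x) = x ^ j * f x) :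
    ∫ x, x ^ j * f x = 2 * ∫ x in Ioi (0 : ℝ), x ^ j * f x := by
  rw [← integral_comp_abs (f := fun x : ℝ => x ^ j * f x)]
  congr 1
  funext x
  rcases abs_choice x with h | h
  · rw [h]
  · rw [h, hf]

/-- Moments of an odd function given by a cosine exponential series. -/
lemma moment_odd {τ : ℝ} (hτ : τ ∈ Icc (0 : ℝ) 1) {f : ℝ → ℝ} (hodd : ∀ x, f (-x) = -f x)
    (hf : ∀ x : ℝ, 0 < x → HasSum
      (fun n : ℕ => Real.cos ((n + 1) * (2 * Real.pi * τ)) * Real.exp (-(2 * (n + 1) * x)))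
      (f x / 2)) (j : ℕ) :
    ((∫ x, x ^ j * f x : ℝ) : ℂ) = -(1 / (j + 1)) *
      (((Real.pi * Complex.I) ^ (j + 1) + (Real.pi * -Complex.I) ^ (j + 1)) *
        Polynomial.aeval (τ : ℂ) (Polynomial.bernoulli (j + 1))) := by
  have hneg : (Real.pi * -Complex.I : ℂ) = -(Real.pi * Complex.I) := by ring
  rcases Nat.even_or_odd j with hj | hj
  · rw [integral_pow_mul_eq_zero (fun x => by rw [hodd, hj.neg_pow]; ring), hneg,
      (hj.add_one).neg_pow]
    simp
  · rw [integral_pow_mul_eq_two_mul (fun x => by rw [hodd, hj.neg_pow]; ring), hneg,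
      (hj.add_one).neg_pow]
    have hj0 : j ≠ 0 := by rintro rfl; simp at hj
    have h1 := hasSum_integral_pow_mul _ (fun n => Real.abs_cos_le_one _) _ hf hj0
    have h2 := hasSum_fourier_bernoulli (by omega : 2 ≤ j + 1) hτ
    have h3 := (Complex.hasSum_ofReal.2 h1).mul_left (4 * 2 ^ j / j.factorial : ℂ)
    have hfac : (j.factorial : ℂ) ≠ 0 := by exact_mod_cast j.factorial_ne_zero
    have h4 := h3.unique (a₁ := _) (by
      convert! h2 using 1
      funext n
      rw [(hj.add_one).neg_one_pow, one_mul, Complex.ofReal_mul, Complex.ofReal_cos, Complex.cos]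
      have : (n + 1 : ℂ) ≠ 0 := by exact_mod_cast n.succ_ne_zero
      push_cast
      rw [mul_pow]
      field_simp
      ring)
    have h5 : (∫ x in Ioi (0 : ℝ), x ^ j * f x) = 2 * ∫ x in Ioi (0 : ℝ), x ^ j * (f x / 2) := by
      rw [← integral_const_mul]; congr 1; funext x; ring
    rw [h5]
    push_cast at h4 ⊢
    have hj1 : (j + 1 : ℂ) ≠ 0 := by exact_mod_cast j.succ_ne_zero
    rw [Nat.factorial_succ] at h4
    generalize ((∫ x in Ioi (0 : ℝ), x ^ j * (f x / 2) : ℝ) : ℂ) = M at h4 ⊢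
    push_cast at h4
    rw [mul_assoc, mul_pow] at h4
    field_simp at h4 ⊢
    have h2j : (2 : ℂ) ^ j ≠ 0 := pow_ne_zero _ two_ne_zero
    refine mul_left_cancel₀ h2j ?_
    linear_combination h4

/-- Moments of an even function given by a sine exponential series. -/
lemma moment_even {τ : ℝ} (hτ : τ ∈ Icc (0 : ℝ) 1) {f : ℝ → ℝ} (heven : ∀ x, f (-x) = f x)
    (hf : ∀ x : ℝ, 0 < x → HasSum
      (fun n : ℕ => Real.sin ((n + 1) * (2 * Real.pi * τ)) * Real.exp (-(2 * (n + 1) * x)))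
      (f x / 2)) {j : ℕ} (hj0 : j ≠ 0) :
    ((∫ x, x ^ j * f x : ℝ) : ℂ) = Complex.I * (1 / (j + 1)) *
      (((Real.pi * Complex.I) ^ (j + 1) - (Real.pi * -Complex.I) ^ (j + 1)) *
        Polynomial.aeval (τ : ℂ) (Polynomial.bernoulli (j + 1))) := by
  have hneg : (Real.pi * -Complex.I : ℂ) = -(Real.pi * Complex.I) := by ring
  rcases Nat.even_or_odd j with hj | hj
  · rw [integral_pow_mul_eq_two_mul (fun x => by rw [heven, hj.neg_pow]), hneg,
      (hj.add_one).neg_pow]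
    have h1 := hasSum_integral_pow_mul _ (fun n => Real.abs_sin_le_one _) _ hf hj0
    have h2 := hasSum_fourier_bernoulli (by omega : 2 ≤ j + 1) hτ
    have h3 := (Complex.hasSum_ofReal.2 h1).mul_left (4 * Complex.I * 2 ^ j / j.factorial : ℂ)
    have hfac : (j.factorial : ℂ) ≠ 0 := by exact_mod_cast j.factorial_ne_zero
    have h4 := h3.unique (a₁ := _) (by
      convert! h2 using 1
      funext n
      rw [(hj.add_one).neg_one_pow, Complex.ofReal_mul, Complex.ofReal_sin, Complex.sin]
      have : (n + 1 : ℂ) ≠ 0 := by exact_mod_cast n.succ_ne_zero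
      push_cast
      rw [mul_pow]
      field_simp
      linear_combination ((2 : ℂ) ^ j * 4 *
        (Complex.exp (-(Complex.I * (n + 1) * 2 * Real.pi * τ))
          - Complex.exp (Complex.I * (n + 1) * 2 * Real.pi * τ))) * Complex.I_sq)
    have h5 : (∫ x in Ioi (0 : ℝ), x ^ j * f x) = 2 * ∫ x in Ioi (0 : ℝ), x ^ j * (f x / 2) := by
      rw [← integral_const_mul]; congr 1; funext x; ring
    rw [h5]
    push_cast at h4 ⊢
    have hj1 : (j + 1 : ℂ) ≠ 0 := by exact_mod_cast j.succ_ne_zero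
    rw [Nat.factorial_succ] at h4
    generalize ((∫ x in Ioi (0 : ℝ), x ^ j * (f x / 2) : ℝ) : ℂ) = M at h4 ⊢
    push_cast at h4
    rw [mul_assoc, mul_pow] at h4
    field_simp at h4 ⊢
    have h2j : (2 : ℂ) ^ j ≠ 0 := pow_ne_zero _ two_ne_zero
    refine mul_left_cancel₀ h2j ?_
    linear_combination (-Complex.I) * h4 + 4 * 2 ^ j * M * (j + 1) * Complex.I_sq
  · rw [integral_pow_mul_eq_zero (fun x => by rw [heven, hj.neg_pow]; ring), hneg,
      (hj.add_one).neg_pow]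
    simp

/-- `coth x` minus its sign at infinity. -/
noncomputable def kerCoth (x : ℝ) : ℝ := Real.cosh x / Real.sinh x - Real.sign x

/-- `sinh 2x / (cosh 2x + 1/2)` minus its sign at infinity. -/
noncomputable def kerOdd (x : ℝ) : ℝ :=
  Real.sinh (2 * x) / (Real.cosh (2 * x) + 1 / 2) - Real.sign x

/-- The kernel `(√3 / 2) / (cosh 2x + 1/2)`. -/
noncomputable def kerEven (x : ℝ) : ℝ := (√3 / 2) / (Real.cosh (2 * x) + 1 / 2)

lemma sign_neg' (x : ℝ) : Real.sign (-x) = -Real.sign x := by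
  rcases lt_trichotomy x 0 with h | h | h
  · rw [Real.sign_of_neg h, Real.sign_of_pos (by linarith), neg_neg]
  · simp [h]
  · rw [Real.sign_of_pos h, Real.sign_of_neg (by linarith)]

lemma kerCoth_neg (x : ℝ) : kerCoth (-x) = -kerCoth x := by
  simp only [kerCoth, Real.cosh_neg, Real.sinh_neg, sign_neg', div_neg]; ring

lemma kerOdd_neg (x : ℝ) : kerOdd (-x) = -kerOdd x := by
  simp only [kerOdd, mul_neg, Real.cosh_neg, Real.sinh_neg, sign_neg', neg_div]; ring

lemma kerEven_neg (x : ℝ) : kerEven (-x) = kerEven x := by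
  simp only [kerEven, mul_neg, Real.cosh_neg]

lemma kerOdd_of_pos {x : ℝ} (hx : 0 < x) : kerOdd x =
    -(Real.exp (-(2 * x)) + 2 * Real.exp (-(2 * x)) ^ 2)
      / (1 + Real.exp (-(2 * x)) + Real.exp (-(2 * x)) ^ 2) := by
  rw [kerOdd, Real.sign_of_pos hx, Real.sinh_eq, Real.cosh_eq, Real.exp_neg]
  have := Real.exp_pos (2 * x)
  field_simp
  ring

lemma kerEven_eq (x : ℝ) : kerEven x = √3 * Real.exp (-(2 * x))
      / (1 + Real.exp (-(2 * x)) + Real.exp (-(2 * x)) ^ 2) := by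
  rw [kerEven, Real.cosh_eq, Real.exp_neg]
  have := Real.exp_pos (2 * x)
  field_simp
  ring

lemma kerCoth_of_pos {x : ℝ} (hx : 0 < x) : kerCoth x =
    2 * Real.exp (-(2 * x)) / (1 - Real.exp (-(2 * x))) := by
  have h1 : Real.exp (-(2 * x)) < 1 := by rw [Real.exp_lt_one_iff]; linarith
  have h2 := Real.sinh_pos_iff.2 hx
  rw [kerCoth, Real.sign_of_pos hx, sub_eq_iff_eq_add, div_add_one (by linarith),
    div_eq_div_iff h2.ne' (by linarith), Real.sinh_eq, Real.cosh_eq]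
  have h3 : Real.exp (-(2 * x)) = Real.exp (-x) ^ 2 := by
    rw [← Real.exp_nat_mul]; congr 1; push_cast; ring
  have h4 : Real.exp x * Real.exp (-x) = 1 := by rw [← Real.exp_add]; simp
  rw [h3]
  linear_combination (-Real.exp (-x)) * h4

lemma cos_two_pi_third : Real.cos (2 * Real.pi * (1 / 3)) = -(1 / 2) := by
  rw [show 2 * Real.pi * (1 / 3) = Real.pi - Real.pi / 3 by ring, Real.cos_pi_sub,
    Real.cos_pi_div_three]

lemma sin_two_pi_third : Real.sin (2 * Real.pi * (1 / 3)) = √3 / 2 := by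
  rw [show 2 * Real.pi * (1 / 3) = Real.pi - Real.pi / 3 by ring, Real.sin_pi_sub,
    Real.sin_pi_div_three]

lemma hasSum_kerOdd {x : ℝ} (hx : 0 < x) : HasSum
    (fun n : ℕ => Real.cos ((n + 1) * (2 * Real.pi * (1 / 3))) * Real.exp (-(2 * (n + 1) * x)))
      (kerOdd x / 2) := by
  convert! (hasSum_geometric_polar hx _).1 using 1
  rw [kerOdd_of_pos hx, cos_two_pi_third, div_div, div_eq_div_iff (by positivity)
    (by nlinarith [Real.exp_pos (-(2 * x))])]
  ring

lemma hasSum_kerEven {x : ℝ} (hx : 0 < x) : HasSum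
    (fun n : ℕ => Real.sin ((n + 1) * (2 * Real.pi * (1 / 3))) * Real.exp (-(2 * (n + 1) * x)))
      (kerEven x / 2) := by
  convert! (hasSum_geometric_polar hx _).2 using 1
  rw [kerEven_eq, cos_two_pi_third, sin_two_pi_third, div_div, div_eq_div_iff (by positivity)
    (by nlinarith [Real.exp_pos (-(2 * x))])]
  ring

lemma hasSum_kerCoth {x : ℝ} (hx : 0 < x) : HasSum
    (fun n : ℕ => Real.cos ((n + 1) * (2 * Real.pi * 0)) * Real.exp (-(2 * (n + 1) * x)))
      (kerCoth x / 2) := by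
  have h1 : Real.exp (-(2 * x)) < 1 := by rw [Real.exp_lt_one_iff]; linarith
  convert! (hasSum_geometric_polar hx _).1 using 1
  rw [kerCoth_of_pos hx, mul_zero, Real.cos_zero, div_div, div_eq_div_iff (by linarith)
    (by nlinarith)]
  ring

lemma measurable_sign : Measurable Real.sign := by
  unfold Real.sign
  exact Measurable.ite measurableSet_Iio measurable_const
    (Measurable.ite measurableSet_Ioi measurable_const measurable_const)

lemma measurable_kerCoth : Measurable kerCoth :=
  (Real.continuous_cosh.measurable.div Real.continuous_sinh.measurable).sub measurable_sign

lemma measurable_kerOdd : Measurable kerOdd :=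
  ((Real.continuous_sinh.measurable.comp (measurable_const_mul 2)).div
    ((Real.continuous_cosh.measurable.comp (measurable_const_mul 2)).add_const _)).sub
      measurable_sign

lemma measurable_kerEven : Measurable kerEven :=
  measurable_const.div ((Real.continuous_cosh.measurable.comp (measurable_const_mul 2)).add_const _)

lemma exp_neg_two_mul_le {x : ℝ} (hx : 0 < x) : Real.exp (-(2 * x)) ≤ Real.exp (-x) :=
  Real.exp_le_exp.2 (by linarith)

lemma abs_kerOdd_le (x : ℝ) : |kerOdd x| ≤ 3 * Real.exp (-|x|) := by
  wlog hx : 0 < x generalizing x with H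
  · rcases (not_lt.1 hx).eq_or_lt with rfl | h
    · simp [kerOdd]
    · simpa [kerOdd_neg] using H (-x) (by linarith)
  have h0 := Real.exp_pos (-(2 * x))
  have h1 : Real.exp (-(2 * x)) < 1 := by rw [Real.exp_lt_one_iff]; linarith
  rw [kerOdd_of_pos hx, abs_of_pos hx, neg_div, abs_neg, abs_of_pos (by positivity)]
  refine le_trans ?_ (mul_le_mul_of_nonneg_left (exp_neg_two_mul_le hx) (by norm_num))
  rw [div_le_iff₀ (by positivity)]
  nlinarith [pow_pos h0 2, pow_pos h0 3]

lemma abs_kerEven_le (x : ℝ) : |kerEven x| ≤ 2 * Real.exp (-|x|) := by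
  wlog hx : 0 ≤ x generalizing x with H
  · simpa [kerEven_neg] using H (-x) (by linarith)
  have h0 := Real.exp_pos (-(2 * x))
  have h3 : √3 ≤ 2 := Real.sqrt_le_iff.2 (by norm_num)
  rw [kerEven_eq, abs_of_nonneg hx, abs_of_pos (by positivity)]
  refine le_trans ?_ (mul_le_mul_of_nonneg_left
    (Real.exp_le_exp.2 (by linarith : -(2 * x) ≤ -x)) (by norm_num))
  rw [div_le_iff₀ (by positivity)]
  nlinarith [pow_pos h0 2, pow_pos h0 3]

lemma abs_mul_kerCoth_le (x : ℝ) : |x * kerCoth x| ≤ Real.exp (-|x|) := by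
  wlog hx : 0 < x generalizing x with H
  · rcases (not_lt.1 hx).eq_or_lt with rfl | h
    · simp
    · simpa [kerCoth_neg] using H (-x) (by linarith)
  have h0 := Real.exp_pos (-x)
  have h1 : Real.exp (-(2 * x)) < 1 := by rw [Real.exp_lt_one_iff]; linarith
  have h2 : 0 < 1 - Real.exp (-(2 * x)) := by linarith
  have h3 : Real.exp (-(2 * x)) = Real.exp (-x) ^ 2 := by
    rw [← Real.exp_nat_mul]; congr 1; push_cast; ring
  have h4 : Real.exp x * Real.exp (-x) = 1 := by rw [← Real.exp_add]; simp
  have h5 := Real.self_le_sinh_iff.2 hx.le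
  rw [Real.sinh_eq] at h5
  rw [kerCoth_of_pos hx, abs_of_pos hx, abs_of_pos (by positivity), mul_div_assoc',
    div_le_iff₀ h2, h3]
  nlinarith [mul_le_mul_of_nonneg_left h5 (pow_pos h0 2).le]

lemma integrable_pow_mul_of_abs_le {f : ℝ → ℝ} (hf : Measurable f) {C : ℝ}
    (h : ∀ x, |f x| ≤ C * Real.exp (-|x|)) (j : ℕ) : Integrable fun x => x ^ j * f x := by
  refine ((integrable_pow_mul_exp_neg_abs j).const_mul C).mono'
    (by fun_prop) (.of_forall fun x => ?_)
  rw [Real.norm_eq_abs, abs_mul, abs_pow]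
  nlinarith [mul_le_mul_of_nonneg_left (h x) (pow_nonneg (abs_nonneg x) j)]

lemma integrable_kerOdd (j : ℕ) : Integrable fun x => x ^ j * kerOdd x :=
  integrable_pow_mul_of_abs_le measurable_kerOdd abs_kerOdd_le j

lemma integrable_kerEven (j : ℕ) : Integrable fun x => x ^ j * kerEven x :=
  integrable_pow_mul_of_abs_le measurable_kerEven abs_kerEven_le j

lemma integrable_kerCoth (j : ℕ) : Integrable fun x => x ^ (j + 1) * kerCoth x := by
  simp only [pow_succ, mul_assoc]
  exact integrable_pow_mul_of_abs_le (measurable_id.mul measurable_kerCoth) (C := 1)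
    (fun x => by simpa using abs_mul_kerCoth_le x) j

lemma integral_kerEven : ∫ x, kerEven x = Real.pi / 3 := by
  have hderiv (x : ℝ) : HasDerivAt (fun x => Real.arctan ((2 * Real.exp (2 * x) + 1) / √3))
      (kerEven x) x := by
    have h1 : HasDerivAt (fun x : ℝ => Real.exp (2 * x)) (Real.exp (2 * x) * (2 * 1)) x :=
      ((hasDerivAt_id x).const_mul 2).exp
    convert! (((h1.const_mul 2).add_const 1).div_const √3).arctan using 1
    have := Real.exp_pos (2 * x)
    have h3 : √3 ^ 2 = 3 := Real.sq_sqrt (by norm_num)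
    have h4 : 0 < √3 := by positivity
    rw [kerEven_eq, Real.exp_neg, div_pow, h3]
    field_simp
    rw [h3]
    ring
  have hint : Integrable kerEven := by simpa using integrable_kerEven 0
  have hbot : Filter.Tendsto (fun x => Real.arctan ((2 * Real.exp (2 * x) + 1) / √3))
      Filter.atBot (nhds (Real.pi / 6)) := by
    have h1 : Filter.Tendsto (fun x : ℝ => Real.exp (2 * x)) Filter.atBot (nhds 0) :=
      Real.tendsto_exp_atBot.comp (Filter.tendsto_id.const_mul_atBot (by norm_num))
    have h2 := (Real.continuous_arctan.tendsto _).comp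
      (((h1.const_mul 2).add_const 1).div_const √3)
    have h3 : Real.arctan ((2 * 0 + 1) / √3) = Real.pi / 6 := by
      rw [mul_zero, zero_add, ← Real.tan_pi_div_six,
        Real.arctan_tan (by linarith [Real.pi_pos]) (by linarith [Real.pi_pos])]
    rwa [h3] at h2
  have htop : Filter.Tendsto (fun x => Real.arctan ((2 * Real.exp (2 * x) + 1) / √3))
      Filter.atTop (nhds (Real.pi / 2)) := by
    have h1 : Filter.Tendsto (fun x : ℝ => Real.exp (2 * x)) Filter.atTop Filter.atTop :=
      Real.tendsto_exp_atTop.comp (Filter.tendsto_id.const_mul_atTop (by norm_num))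
    have h2 := (Filter.tendsto_atTop_add_const_right _ 1
      (h1.const_mul_atTop (by norm_num : (0 : ℝ) < 2))).atTop_div_const
        (by positivity : (0 : ℝ) < √3)
    exact (Real.tendsto_arctan_atTop.mono_right nhdsWithin_le_nhds).comp h2
  rw [integral_of_hasDerivAt_of_tendsto hderiv hint hbot htop]
  ring

lemma moment_kerOdd (j : ℕ) : ((∫ x, x ^ j * kerOdd x : ℝ) : ℂ) = -(1 / (j + 1)) *
      (((Real.pi * Complex.I) ^ (j + 1) + (Real.pi * -Complex.I) ^ (j + 1)) *
        Polynomial.aeval ((1 / 3 : ℝ) : ℂ) (Polynomial.bernoulli (j + 1))) :=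
  moment_odd (by norm_num) kerOdd_neg (fun _ hx => hasSum_kerOdd hx) j

lemma moment_kerCoth (j : ℕ) : ((∫ x, x ^ j * kerCoth x : ℝ) : ℂ) = -(1 / (j + 1)) *
      (((Real.pi * Complex.I) ^ (j + 1) + (Real.pi * -Complex.I) ^ (j + 1)) *
        Polynomial.aeval ((0 : ℝ) : ℂ) (Polynomial.bernoulli (j + 1))) :=
  moment_odd (by norm_num) kerCoth_neg (fun _ hx => hasSum_kerCoth hx) j

lemma moment_kerEven (j : ℕ) : ((∫ x, x ^ j * kerEven x : ℝ) : ℂ) = Complex.I * (1 / (j + 1)) *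
      (((Real.pi * Complex.I) ^ (j + 1) - (Real.pi * -Complex.I) ^ (j + 1)) *
        Polynomial.aeval ((1 / 3 : ℝ) : ℂ) (Polynomial.bernoulli (j + 1))) := by
  rcases eq_or_ne j 0 with rfl | hj
  · simp only [pow_zero, one_mul, integral_kerEven, zero_add, pow_one, Polynomial.bernoulli_one]
    simp only [map_sub, Polynomial.aeval_X, Polynomial.aeval_C]
    push_cast
    simp only [map_ofNat]
    linear_combination (Real.pi / 3 : ℂ) * Complex.I_sq
  · exact moment_even (by norm_num) kerEven_neg (fun _ hx => hasSum_kerEven hx) hj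

lemma integral_add_pow_mul {f : ℝ → ℝ} (hf : ∀ j : ℕ, Integrable fun x => x ^ j * f x)
    (l : ℝ) (k : ℕ) : ∫ x, (x + l) ^ k * f x
      = ∑ j ∈ Finset.range (k + 1), l ^ (k - j) * k.choose j * ∫ x, x ^ j * f x := by
  simp only [← integral_const_mul]
  rw [← integral_finsetSum _ fun j _ => (hf j).const_mul _]
  congr 1
  funext x
  rw [add_pow, Finset.sum_mul]
  exact Finset.sum_congr rfl fun j _ => by ring

lemma integrable_add_pow_mul {f : ℝ → ℝ} (hf : ∀ j : ℕ, Integrable fun x => x ^ j * f x)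
    (l : ℝ) (k : ℕ) : Integrable fun x => (x + l) ^ k * f x := by
  simp only [add_pow, Finset.sum_mul]
  refine integrable_finsetSum _ fun j _ => ((hf j).const_mul (l ^ (k - j) * k.choose j)).congr
    (.of_forall fun x => ?_)
  ring

lemma add_pow_sub_pow_mul (f : ℝ → ℝ) (l x : ℝ) (k : ℕ) : ((x + l) ^ k - l ^ k) * f x
    = ∑ j ∈ Finset.range k, l ^ (k - (j + 1)) * k.choose (j + 1) * (x ^ (j + 1) * f x) := by
  rw [add_pow, Finset.sum_range_succ']
  simp only [pow_zero, Nat.sub_zero, Nat.choose_zero_right, Nat.cast_one, mul_one, one_mul,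
    add_sub_cancel_right, Finset.sum_mul]
  exact Finset.sum_congr rfl fun j _ => by ring

lemma integrable_add_pow_sub_pow_mul {f : ℝ → ℝ}
    (hf : ∀ j : ℕ, Integrable fun x => x ^ (j + 1) * f x)
    (l : ℝ) (k : ℕ) : Integrable fun x => ((x + l) ^ k - l ^ k) * f x := by
  simp only [add_pow_sub_pow_mul f]
  exact integrable_finsetSum _ fun j _ => (hf j).const_mul _

lemma integral_add_pow_sub_pow_mul {f : ℝ → ℝ}
    (hf : ∀ j : ℕ, Integrable fun x => x ^ (j + 1) * f x) (h0 : ∫ x, x ^ 0 * f x = 0)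
    (l : ℝ) (k : ℕ) : ∫ x, ((x + l) ^ k - l ^ k) * f x
      = ∑ j ∈ Finset.range (k + 1), l ^ (k - j) * k.choose j * ∫ x, x ^ j * f x := by
  rw [Finset.sum_range_succ', h0, mul_zero, add_zero]
  simp only [← integral_const_mul]
  rw [← integral_finsetSum _ fun j _ => (hf j).const_mul _]
  simp only [add_pow_sub_pow_mul f]

lemma succ_mul_bernSum_tail (c : ℂ) (τ l : ℝ) (k : ℕ) :
    ∑ j ∈ Finset.range (k + 1), (l : ℂ) ^ (k - j) * k.choose j *
      (1 / (j + 1) * (c ^ (j + 1) * Polynomial.aeval (τ : ℂ) (Polynomial.bernoulli (j + 1))))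
      = (bernSum c τ l (k + 1) - l ^ (k + 1)) / (k + 1) := by
  have hk : (k + 1 : ℂ) ≠ 0 := by exact_mod_cast k.succ_ne_zero
  rw [eq_div_iff hk, bernSum, Finset.sum_range_succ' _ (k + 1), Finset.sum_mul]
  simp only [Nat.choose_zero_right, Nat.cast_one, pow_zero, Polynomial.bernoulli_zero, map_one,
    mul_one, one_mul, Nat.sub_zero, add_sub_cancel_right, Nat.add_sub_add_right]
  refine Finset.sum_congr rfl fun j _ => ?_
  have hj : (j + 1 : ℂ) ≠ 0 := by exact_mod_cast j.succ_ne_zero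
  have h : ((k + 1 : ℂ)) * k.choose j = (k + 1).choose (j + 1) * (j + 1) := by
    exact_mod_cast Nat.add_one_mul_choose_eq k j
  field_simp
  linear_combination (l ^ (k - j) * (c ^ (j + 1) *
    Polynomial.aeval (τ : ℂ) (Polynomial.bernoulli (j + 1))) : ℂ) * h

lemma sum_moment_even (τ l : ℝ) (k : ℕ) :
    ∑ j ∈ Finset.range (k + 1), (l : ℂ) ^ (k - j) * k.choose j *
      (-(1 / (j + 1)) * (((Real.pi * Complex.I) ^ (j + 1) + (Real.pi * -Complex.I) ^ (j + 1)) *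
        Polynomial.aeval (τ : ℂ) (Polynomial.bernoulli (j + 1))))
      = -(bernPlus τ l (k + 1) + bernMinus τ l (k + 1) - 2 * l ^ (k + 1)) / (k + 1) := by
  have h1 := succ_mul_bernSum_tail (Real.pi * Complex.I) τ l k
  have h2 := succ_mul_bernSum_tail (Real.pi * -Complex.I) τ l k
  calc _ = -((bernPlus τ l (k + 1) - l ^ (k + 1)) / (k + 1)
        + (bernMinus τ l (k + 1) - l ^ (k + 1)) / (k + 1)) := by
        rw [bernPlus, bernMinus, ← h1, ← h2, ← Finset.sum_add_distrib, ← Finset.sum_neg_distrib]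
        exact Finset.sum_congr rfl fun j _ => by ring
    _ = _ := by ring

lemma sum_moment_odd (τ l : ℝ) (k : ℕ) :
    ∑ j ∈ Finset.range (k + 1), (l : ℂ) ^ (k - j) * k.choose j *
      (Complex.I * (1 / (j + 1)) *
        (((Real.pi * Complex.I) ^ (j + 1) - (Real.pi * -Complex.I) ^ (j + 1)) *
        Polynomial.aeval (τ : ℂ) (Polynomial.bernoulli (j + 1))))
      = Complex.I * (bernPlus τ l (k + 1) - bernMinus τ l (k + 1)) / (k + 1) := by
  have h1 := succ_mul_bernSum_tail (Real.pi * Complex.I) τ l k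
  have h2 := succ_mul_bernSum_tail (Real.pi * -Complex.I) τ l k
  calc _ = Complex.I * ((bernPlus τ l (k + 1) - l ^ (k + 1)) / (k + 1)
        - (bernMinus τ l (k + 1) - l ^ (k + 1)) / (k + 1)) := by
        rw [bernPlus, bernMinus, ← h1, ← h2, ← Finset.sum_sub_distrib, Finset.mul_sum]
        exact Finset.sum_congr rfl fun j _ => by ring
    _ = _ := by ring

lemma integral_kerOdd_shift (l : ℝ) (k : ℕ) : ((∫ x, (x + l) ^ k * kerOdd x : ℝ) : ℂ)
    = -(bernPlus (1 / 3) l (k + 1) + bernMinus (1 / 3) l (k + 1) - 2 * l ^ (k + 1)) / (k + 1) := by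
  rw [integral_add_pow_mul integrable_kerOdd, ← sum_moment_even]
  simp only [← moment_kerOdd]
  push_cast
  rfl

lemma integral_kerEven_shift (l : ℝ) (k : ℕ) : ((∫ x, (x + l) ^ k * kerEven x : ℝ) : ℂ)
    = Complex.I * (bernPlus (1 / 3) l (k + 1) - bernMinus (1 / 3) l (k + 1)) / (k + 1) := by
  rw [integral_add_pow_mul integrable_kerEven, ← sum_moment_odd]
  simp only [← moment_kerEven]
  push_cast
  rfl

lemma integral_kerCoth_shift (l : ℝ) (k : ℕ) :
    ((∫ x, ((x + l) ^ k - l ^ k) * kerCoth x : ℝ) : ℂ)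
    = -(bernPlus 0 l (k + 1) + bernMinus 0 l (k + 1) - 2 * l ^ (k + 1)) / (k + 1) := by
  rw [integral_add_pow_sub_pow_mul integrable_kerCoth
    (integral_pow_mul_eq_zero fun x => by simp [kerCoth_neg]), ← sum_moment_even]
  simp only [← moment_kerCoth]
  push_cast
  rfl

/-- The contribution of the jump of the sign function. -/
lemma sign_sub_sign (d : ℝ) : (fun x => Real.sign x - Real.sign (x - d))
    =ᵐ[volume] fun x => 2 * ((Ioc 0 d).indicator 1 x - (Ioc d 0).indicator 1 x) := by
  have h : ∀ᵐ x : ℝ, x ≠ 0 ∧ x ≠ d := by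
    exact (Measure.ae_ne volume 0).and (Measure.ae_ne volume d)
  filter_upwards [h] with x hx
  obtain ⟨h0, h1⟩ := hx
  simp only [indicator, Set.mem_Ioc, Pi.one_apply]
  rcases lt_or_gt_of_ne h0 with h2 | h2 <;> rcases lt_or_gt_of_ne h1 with h3 | h3
  · rw [Real.sign_of_neg h2, Real.sign_of_neg (by linarith), if_neg (by rintro ⟨h, h'⟩; linarith),
      if_neg (by rintro ⟨h, h'⟩; linarith)]; norm_num
  · rw [Real.sign_of_neg h2, Real.sign_of_pos (by linarith), if_neg (by rintro ⟨h, h'⟩; linarith),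
      if_pos ⟨h3, h2.le⟩]; norm_num
  · rw [Real.sign_of_pos h2, Real.sign_of_neg (by linarith), if_pos ⟨h2, h3.le⟩,
      if_neg (by rintro ⟨h, h'⟩; linarith)]; norm_num
  · rw [Real.sign_of_pos h2, Real.sign_of_pos (by linarith), if_neg (by rintro ⟨h, h'⟩; linarith),
      if_neg (by rintro ⟨h, h'⟩; linarith)]; norm_num

lemma pow_mul_sign_sub_sign (l d : ℝ) (k : ℕ) :
    (fun x => (x + l) ^ k * (Real.sign x - Real.sign (x - d))) =ᵐ[volume]
      fun x => 2 * ((Ioc 0 d).indicator (fun x => (x + l) ^ k) x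
        - (Ioc d 0).indicator (fun x => (x + l) ^ k) x) := by
  filter_upwards [sign_sub_sign d] with x hx
  rw [hx]
  simp only [indicator, Pi.one_apply]
  split_ifs <;> ring

lemma integrable_indicator_pow (l u v : ℝ) (k : ℕ) :
    Integrable ((Ioc u v).indicator fun x : ℝ => (x + l) ^ k) :=
  ((by fun_prop : Continuous fun x : ℝ => (x + l) ^ k).integrableOn_Ioc).integrable_indicator
    measurableSet_Ioc

lemma integrable_sign_sub_sign (l d : ℝ) (k : ℕ) :
    Integrable fun x => (x + l) ^ k * (Real.sign x - Real.sign (x - d)) :=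
  (((integrable_indicator_pow l 0 d k).sub (integrable_indicator_pow l d 0 k)).const_mul 2).congr
    (pow_mul_sign_sub_sign l d k).symm

lemma integral_sign_sub_sign (l d : ℝ) (k : ℕ) :
    ∫ x, (x + l) ^ k * (Real.sign x - Real.sign (x - d))
      = 2 * ((d + l) ^ (k + 1) - l ^ (k + 1)) / (k + 1) := by
  rw [integral_congr_ae (pow_mul_sign_sub_sign l d k), integral_const_mul,
    integral_sub (integrable_indicator_pow l 0 d k) (integrable_indicator_pow l d 0 k),
    integral_indicator measurableSet_Ioc, integral_indicator measurableSet_Ioc,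
    ← intervalIntegral, intervalIntegral.integral_comp_add_right (fun x => x ^ k), integral_pow]
  ring

lemma hasDerivAt_log_one_sub_exp {x : ℝ} (hx : 0 < x) :
    HasDerivAt (fun x => Real.log (1 - Real.exp (-(2 * x)))) (kerCoth x) x := by
  have h1 : Real.exp (-(2 * x)) < 1 := by rw [Real.exp_lt_one_iff]; linarith
  convert! ((((hasDerivAt_id x).const_mul 2).neg.exp).const_sub 1).log (by simpa using
    (sub_pos.2 h1).ne') using 1
  rw [kerCoth_of_pos hx]
  simp only [Pi.neg_apply, id]
  ring

lemma tendsto_log_one_sub_exp :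
    Filter.Tendsto (fun x => Real.log (1 - Real.exp (-(2 * x)))) Filter.atTop (nhds 0) := by
  have h1 : Filter.Tendsto (fun x : ℝ => Real.exp (-(2 * x))) Filter.atTop (nhds 0) :=
    Real.tendsto_exp_neg_atTop_nhds_zero.comp (Filter.tendsto_id.const_mul_atTop (by norm_num))
  have h2 := ((Real.continuousAt_log (by norm_num : (1 - 0 : ℝ) ≠ 0)).tendsto).comp
    (h1.const_sub 1)
  simpa using! h2

lemma integrableOn_kerCoth_Ioi {u : ℝ} (hu : 0 < u) : IntegrableOn kerCoth (Ioi u) := by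
  refine integrableOn_Ioi_deriv_of_nonneg'
    (fun x hx => hasDerivAt_log_one_sub_exp (hu.trans_le hx)) (fun x hx => ?_)
    tendsto_log_one_sub_exp
  have hx' : 0 < x := hu.trans hx
  have h1 : Real.exp (-(2 * x)) < 1 := by rw [Real.exp_lt_one_iff]; linarith
  rw [kerCoth_of_pos hx']
  have := sub_pos.2 h1
  positivity

lemma integral_kerCoth_Ioi {u : ℝ} (hu : 0 < u) :
    ∫ x in Ioi u, kerCoth x = -Real.log (1 - Real.exp (-(2 * u))) := by
  rw [integral_Ioi_of_hasDerivAt_of_tendsto'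
    (fun x hx => hasDerivAt_log_one_sub_exp (hu.trans_le hx)) (integrableOn_kerCoth_Ioi hu)
    tendsto_log_one_sub_exp, zero_sub]

lemma integrableOn_kerCoth_Iio {u : ℝ} (hu : u < 0) : IntegrableOn kerCoth (Iio u) := by
  have h := (integrableOn_kerCoth_Ioi (neg_pos.2 hu)).comp_neg
  simpa [kerCoth_neg, integrable_neg_iff, IntegrableOn] using h

lemma integral_kerCoth_Iio {u : ℝ} (hu : u < 0) :
    ∫ x in Iio u, kerCoth x = Real.log (1 - Real.exp (2 * u)) := by
  have h := integral_comp_neg_Iic u kerCoth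
  simp only [kerCoth_neg, integral_neg, integral_kerCoth_Ioi (neg_pos.2 hu)] at h
  rw [← integral_Iic_eq_integral_Iio]
  simpa using h

lemma tendsto_cutout_of_integrable {g : ℝ → ℝ} (hg : Integrable g) {p q : ℝ → ℝ}
    {F : Filter ℝ} (hp : Filter.Tendsto p F (nhds 0)) (hq : Filter.Tendsto q F (nhds 0)) :
    Filter.Tendsto (fun ε => (∫ x in Iio (p ε), g x) + ∫ x in Ioi (q ε), g x) F
      (nhds (∫ x, g x)) := by
  have hc := intervalIntegral.continuous_primitive
    (fun u v => hg.intervalIntegrable (a := u) (b := v)) 0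
  have h0 : ∫ x in (0 : ℝ)..0, g x = 0 := intervalIntegral.integral_same
  have h1 := (hc.tendsto 0).comp hp
  have h2 := (hc.tendsto 0).comp hq
  rw [h0] at h1 h2
  have h3 := ((h1.const_add (∫ x in Iic (0 : ℝ), g x)).add
    (h2.const_sub (∫ x in Ioi (0 : ℝ), g x)))
  rw [add_zero, sub_zero, intervalIntegral.integral_Iic_add_Ioi hg.integrableOn hg.integrableOn]
    at h3
  refine h3.congr fun ε => ?_
  simp only [Function.comp_apply]
  rw [← intervalIntegral.integral_Iic_sub_Iic hg.integrableOn hg.integrableOn,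
    ← intervalIntegral.integral_Ioi_sub_Ioi' hg.integrableOn hg.integrableOn,
    ← integral_Iic_eq_integral_Iio]
  ring

lemma image_mul_exp_Iio {α s : ℝ} (hα : 0 < α) (hs : 0 < s) :
    (fun q => α * Real.exp q) '' Iio (Real.log (s / α)) = Ioo 0 s := by
  ext t
  simp only [mem_image, Set.mem_Iio, Set.mem_Ioo]
  constructor
  · rintro ⟨q, hq, rfl⟩
    rw [Real.lt_log_iff_exp_lt (by positivity), lt_div_iff₀ hα] at hq
    exact ⟨by positivity, by linarith⟩
  · rintro ⟨h0, h1⟩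
    refine ⟨Real.log (t / α), Real.log_lt_log (by positivity) (by gcongr), ?_⟩
    rw [Real.exp_log (by positivity)]
    field_simp

lemma image_mul_exp_Ioi {α s : ℝ} (hα : 0 < α) (hs : 0 < s) :
    (fun q => α * Real.exp q) '' Ioi (Real.log (s / α)) = Ioi s := by
  ext t
  simp only [mem_image, Set.mem_Ioi]
  constructor
  · rintro ⟨q, hq, rfl⟩
    rw [Real.log_lt_iff_lt_exp (by positivity), div_lt_iff₀ hα] at hq
    linarith
  · intro h1
    have h0 : 0 < t := hs.trans h1
    refine ⟨Real.log (t / α), Real.log_lt_log (by positivity) (by gcongr), ?_⟩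
    rw [Real.exp_log (by positivity)]
    field_simp

lemma integral_image_mul_exp {α : ℝ} (hα : 0 < α) {s : Set ℝ} (hs : MeasurableSet s)
    (f : ℝ → ℝ) : ∫ t in (fun q => α * Real.exp q) '' s, f t
      = ∫ q in s, α * Real.exp q * f (α * Real.exp q) := by
  rw [integral_image_eq_integral_abs_deriv_smul hs
    (fun q _ => ((Real.hasDerivAt_exp q).const_mul α).hasDerivWithinAt)
    (fun x _ y _ h => Real.exp_injective (mul_left_cancel₀ hα.ne' h))]
  refine setIntegral_congr_fun hs fun q _ => ?_
  simp only [smul_eq_mul, abs_of_pos (mul_pos hα (Real.exp_pos q))]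

/-- The principal value of a function which, in the variable `q = log (t / α)`, is the sum of
a multiple of `kerCoth` and an integrable function. -/
lemma tendsto_principalValue {α : ℝ} (hα : 0 < α) {f g : ℝ → ℝ} (C : ℝ) (hg : Integrable g)
    (hfg : ∀ q, q ≠ 0 → α * Real.exp q * f (α * Real.exp q) = C * kerCoth q + g q) :
    Filter.Tendsto (fun ε => (∫ t in Ioo 0 (α - ε), f t) + ∫ t in Ioi (α + ε), f t)
      (nhdsWithin 0 (Ioi 0)) (nhds (∫ q, g q)) := by
  have hlog {σ : ℝ} : Filter.Tendsto (fun ε => Real.log ((α + σ * ε) / α)) (nhdsWithin 0 (Ioi 0))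
      (nhds 0) := by
    have h : ContinuousAt (fun ε => Real.log ((α + σ * ε) / α)) 0 :=
      ContinuousAt.log (by fun_prop) (by simp [hα.ne'])
    have h1 := h.tendsto
    simp only [mul_zero, add_zero, div_self hα.ne', Real.log_one] at h1
    exact h1.mono_left nhdsWithin_le_nhds
  have hreg := tendsto_cutout_of_integrable hg (hlog (σ := -1)) (hlog (σ := 1))
  have hsing : Filter.Tendsto (fun ε => C * (Real.log ((2 * α - ε) / (2 * α + ε))
      + 2 * Real.log ((α + ε) / α))) (nhdsWithin 0 (Ioi 0)) (nhds 0) := by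
    have h : ContinuousAt (fun ε => C * (Real.log ((2 * α - ε) / (2 * α + ε))
      + 2 * Real.log ((α + ε) / α))) 0 := by
      refine continuousAt_const.mul (ContinuousAt.add (ContinuousAt.log (ContinuousAt.div
        (by fun_prop) (by fun_prop) (by simp [hα.ne'])) (by simp [hα.ne']))
        (continuousAt_const.mul (ContinuousAt.log (by fun_prop) (by simp [hα.ne']))))
    have h1 := h.tendsto
    simp only [sub_zero, add_zero, div_self hα.ne', div_self (mul_pos two_pos hα).ne',
      Real.log_one, mul_zero] at h1
    exact h1.mono_left nhdsWithin_le_nhds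
  have h := hsing.add hreg
  rw [zero_add] at h
  refine h.congr' ?_
  filter_upwards [Ioo_mem_nhdsGT hα] with ε hε
  obtain ⟨h0, h1⟩ := hε
  have hm : 0 < α - ε := by linarith
  have hp : 0 < α + ε := by linarith
  have hqm : Real.log ((α - ε) / α) < 0 :=
    Real.log_neg (by positivity) (by rw [div_lt_one hα]; linarith)
  have hqp : 0 < Real.log ((α + ε) / α) :=
    Real.log_pos (by rw [one_lt_div hα]; linarith)
  rw [← image_mul_exp_Iio hα hm, ← image_mul_exp_Ioi hα hp,
    integral_image_mul_exp hα measurableSet_Iio, integral_image_mul_exp hα measurableSet_Ioi,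
    setIntegral_congr_fun measurableSet_Iio fun q hq => hfg q (hq.trans hqm).ne,
    setIntegral_congr_fun measurableSet_Ioi fun q hq => hfg q (hqp.trans hq).ne',
    integral_add ((integrableOn_kerCoth_Iio hqm).const_mul C) hg.integrableOn,
    integral_add ((integrableOn_kerCoth_Ioi hqp).const_mul C) hg.integrableOn,
    integral_const_mul, integral_const_mul, integral_kerCoth_Iio hqm, integral_kerCoth_Ioi hqp]
  have he (y : ℝ) (hy : 0 < y) : Real.exp (2 * Real.log y) = y ^ 2 := by
    rw [mul_comm, Real.exp_mul, Real.exp_log hy]; norm_cast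
  have hL : Real.log ((2 * α - ε) / (2 * α + ε)) + 2 * Real.log ((α + ε) / α)
      = Real.log (1 - Real.exp (2 * Real.log ((α - ε) / α)))
        - Real.log (1 - Real.exp (-(2 * Real.log ((α + ε) / α)))) := by
    have e1 : 1 - ((α - ε) / α) ^ 2 = ε * (2 * α - ε) / α ^ 2 := by field_simp; ring
    have e2 : 1 - (((α + ε) / α) ^ 2)⁻¹ = ε * (2 * α + ε) / (α + ε) ^ 2 := by field_simp; ring
    have h2m : 0 < 2 * α - ε := by linarith
    rw [he _ (by positivity), Real.exp_neg, he _ (by positivity), e1, e2,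
      Real.log_div (by positivity) (by positivity), Real.log_div (by positivity) (by positivity),
      Real.log_div (by positivity) (by positivity), Real.log_div (by positivity) (by positivity),
      Real.log_mul (by positivity) (by positivity), Real.log_mul (by positivity) (by positivity),
      Real.log_pow, Real.log_pow]
    push_cast
    ring
  rw [hL, neg_one_mul, one_mul, ← sub_eq_add_neg]
  ring

lemma kerCoth_add_sign {c t : ℝ} (hc : 0 < c) (ht : 0 < t) :
    kerCoth (Real.log (t / c)) + Real.sign (Real.log (t / c))
      = (t ^ 2 + c ^ 2) / (t ^ 2 - c ^ 2) := by
  rw [kerCoth, sub_add_cancel, Real.cosh_log (by positivity), Real.sinh_log (by positivity),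
    div_div_div_cancel_right₀ two_ne_zero, inv_div, div_add_div _ _ hc.ne' ht.ne',
    div_sub_div _ _ hc.ne' ht.ne', div_div_div_cancel_right₀ (by positivity)]
  ring

lemma two_mul_log (x : ℝ) : 2 * Real.log x = Real.log (x ^ 2) := by
  rw [Real.log_pow]; norm_cast

lemma kerOdd_add_sign {c t : ℝ} (hc : 0 < c) (ht : 0 < t) :
    kerOdd (Real.log (t / c)) + Real.sign (Real.log (t / c))
      = (t ^ 4 - c ^ 4) / (t ^ 4 + c ^ 2 * t ^ 2 + c ^ 4) := by
  rw [kerOdd, sub_add_cancel, two_mul_log, Real.cosh_log (by positivity),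
    Real.sinh_log (by positivity)]
  field_simp
  ring

lemma kerEven_log {c t : ℝ} (hc : 0 < c) (ht : 0 < t) :
    kerEven (Real.log (t / c)) = √3 * (c ^ 2 * t ^ 2) / (t ^ 4 + c ^ 2 * t ^ 2 + c ^ 4) := by
  rw [kerEven, two_mul_log, Real.cosh_log (by positivity)]
  field_simp
  ring

lemma quadratic_pos {c t : ℝ} (hc : c ≠ 0) : 0 < t ^ 2 + c * t + c ^ 2 := by
  have := pow_pos (abs_pos.2 hc) 2
  rw [sq_abs] at this
  nlinarith [sq_nonneg (2 * t + c)]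

lemma partial_fractions {a b t : ℝ} (ha : a ≠ 0) (hb : b ≠ 0) (hab : a ^ 3 ≠ b ^ 3)
    (hta : t ^ 2 ≠ a ^ 2) :
    t * (t * (t + a) / ((t ^ 3 - a ^ 3) * (t ^ 2 + b * t + b ^ 2))
      + t * (t - a) / ((t ^ 3 + a ^ 3) * (t ^ 2 - b * t + b ^ 2)))
    = 1 / (3 * (a ^ 2 + a * b + b ^ 2)) * (2 * ((t ^ 2 + a ^ 2) / (t ^ 2 - a ^ 2))
        + (t ^ 4 - a ^ 4) / (t ^ 4 + a ^ 2 * t ^ 2 + a ^ 4)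
        - 3 * ((t ^ 4 - b ^ 4) / (t ^ 4 + b ^ 2 * t ^ 2 + b ^ 4)))
      + (a + b) / (a ^ 3 - b ^ 3) * (a ^ 2 * t ^ 2 / (t ^ 4 + a ^ 2 * t ^ 2 + a ^ 4)
        - b ^ 2 * t ^ 2 / (t ^ 4 + b ^ 2 * t ^ 2 + b ^ 4)) := by
  have hA1 := (quadratic_pos (t := t) ha).ne'
  have hA2 := (quadratic_pos (t := t) (neg_ne_zero.2 ha)).ne'
  have hB1 := (quadratic_pos (t := t) hb).ne'
  have hB2 := (quadratic_pos (t := t) (neg_ne_zero.2 hb)).ne'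
  have hD := (quadratic_pos (t := a) hb).ne'
  rw [neg_sq, neg_mul, ← sub_eq_add_neg] at hA2 hB2
  have hD' : a ^ 2 + a * b + b ^ 2 ≠ 0 := by rwa [mul_comm b a] at hD
  have hd : a - b ≠ 0 := sub_ne_zero.2 (by rintro rfl; exact hab rfl)
  have hta' : (t - a) * (t + a) ≠ 0 := by
    have := sub_ne_zero.2 hta
    convert! this using 1; ring
  have hm := left_ne_zero_of_mul hta'
  have hp := right_ne_zero_of_mul hta'
  rw [show t ^ 3 - a ^ 3 = (t - a) * (t ^ 2 + a * t + a ^ 2) by ring,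
    show t ^ 3 + a ^ 3 = (t + a) * (t ^ 2 - a * t + a ^ 2) by ring,
    show t ^ 2 - a ^ 2 = (t - a) * (t + a) by ring,
    show t ^ 4 + a ^ 2 * t ^ 2 + a ^ 4 = (t ^ 2 + a * t + a ^ 2) * (t ^ 2 - a * t + a ^ 2) by ring,
    show t ^ 4 + b ^ 2 * t ^ 2 + b ^ 4 = (t ^ 2 + b * t + b ^ 2) * (t ^ 2 - b * t + b ^ 2) by ring,
    show a ^ 3 - b ^ 3 = (a - b) * (a ^ 2 + a * b + b ^ 2) by ring]
  generalize hm' : t - a = m at *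
  generalize hp' : t + a = p at *
  generalize hd' : a - b = d at *
  generalize hA1' : t ^ 2 + a * t + a ^ 2 = A₁ at *
  generalize hA2' : t ^ 2 - a * t + a ^ 2 = A₂ at *
  generalize hB1' : t ^ 2 + b * t + b ^ 2 = B₁ at *
  generalize hB2' : t ^ 2 - b * t + b ^ 2 = B₂ at *
  generalize hDD : a ^ 2 + a * b + b ^ 2 = D at *
  field_simp
  subst hm' hp' hd' hA1' hA2' hB1' hB2' hDD
  ring

/-- The integrand in the variable `q`, with the simple pole at `q = 0` removed. -/
noncomputable def regularPart (c κ la lb : ℝ) (k : ℕ) (q : ℝ) : ℝ :=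
  2 * c * (((q + la) ^ k - la ^ k) * kerCoth q)
    + c * ((q + la) ^ k * kerOdd q
      - 3 * (((q - (lb - la)) + lb) ^ k * kerOdd (q - (lb - la)))
      + 3 * ((q + la) ^ k * (Real.sign q - Real.sign (q - (lb - la)))))
    + κ * ((q + la) ^ k * kerEven q
      - ((q - (lb - la)) + lb) ^ k * kerEven (q - (lb - la)))

lemma integrable_shift {f : ℝ → ℝ} (hf : ∀ j : ℕ, Integrable fun x => x ^ j * f x)
    (d l : ℝ) (k : ℕ) : Integrable fun x => ((x - d) + l) ^ k * f (x - d) :=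
  (integrable_add_pow_mul hf l k).comp_sub_right d

lemma integrable_regularPart (c κ la lb : ℝ) (k : ℕ) :
    Integrable (regularPart c κ la lb k) :=
  ((((integrable_add_pow_sub_pow_mul integrable_kerCoth la k).const_mul (2 * c)).add
    ((((integrable_add_pow_mul integrable_kerOdd la k).sub
      ((integrable_shift integrable_kerOdd (lb - la) lb k).const_mul 3)).add
      ((integrable_sign_sub_sign la (lb - la) k).const_mul 3)).const_mul c)).add
    (((integrable_add_pow_mul integrable_kerEven la k).sub
      (integrable_shift integrable_kerEven (lb - la) lb k)).const_mul κ))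

lemma integral_shift (f : ℝ → ℝ) (d l : ℝ) (k : ℕ) :
    ∫ x, ((x - d) + l) ^ k * f (x - d) = ∫ x, (x + l) ^ k * f x :=
  integral_sub_right_eq_self (fun x => (x + l) ^ k * f x) d

lemma integral_regularPart (c κ la lb : ℝ) (k : ℕ) :
    ∫ q, regularPart c κ la lb k q
      = 2 * c * (∫ x, ((x + la) ^ k - la ^ k) * kerCoth x)
        + c * ((∫ x, (x + la) ^ k * kerOdd x) - 3 * (∫ x, (x + lb) ^ k * kerOdd x)
          + 3 * (2 * (lb ^ (k + 1) - la ^ (k + 1)) / (k + 1)))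
        + κ * ((∫ x, (x + la) ^ k * kerEven x) - ∫ x, (x + lb) ^ k * kerEven x) := by
  have i1 := (integrable_add_pow_sub_pow_mul integrable_kerCoth la k).const_mul (2 * c)
  have i2 := integrable_add_pow_mul integrable_kerOdd la k
  have i3 := (integrable_shift integrable_kerOdd (lb - la) lb k).const_mul 3
  have i4 := (integrable_sign_sub_sign la (lb - la) k).const_mul 3
  have i5 := integrable_add_pow_mul integrable_kerEven la k
  have i6 := integrable_shift integrable_kerEven (lb - la) lb k
  have i23 : Integrable fun x => (x + la) ^ k * kerOdd x
      - 3 * (((x - (lb - la)) + lb) ^ k * kerOdd (x - (lb - la))) := i2.sub i3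
  have i56 : Integrable fun x => (x + la) ^ k * kerEven x
      - ((x - (lb - la)) + lb) ^ k * kerEven (x - (lb - la)) := i5.sub i6
  have i7 : Integrable fun x => c * ((x + la) ^ k * kerOdd x
      - 3 * (((x - (lb - la)) + lb) ^ k * kerOdd (x - (lb - la)))
      + 3 * ((x + la) ^ k * (Real.sign x - Real.sign (x - (lb - la))))) :=
    (i23.add i4).const_mul c
  have i17 : Integrable fun x => 2 * c * (((x + la) ^ k - la ^ k) * kerCoth x)
      + c * ((x + la) ^ k * kerOdd x
      - 3 * (((x - (lb - la)) + lb) ^ k * kerOdd (x - (lb - la)))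
      + 3 * ((x + la) ^ k * (Real.sign x - Real.sign (x - (lb - la))))) := i1.add i7
  have hs := integral_sign_sub_sign la (lb - la) k
  rw [sub_add_cancel] at hs
  rw [← hs, ← integral_shift kerOdd (lb - la) lb k, ← integral_shift kerEven (lb - la) lb k]
  unfold regularPart
  rw [integral_add i17 (i56.const_mul κ), integral_add i1 i7, integral_const_mul,
    integral_const_mul,
    integral_const_mul, integral_add i23 i4, integral_sub i2 i3, integral_sub i5 i6,
    integral_const_mul, integral_const_mul]

lemma integrand_eq {a b : ℝ} (ha : a ≠ 0) (hb : b ≠ 0) (hab : a ^ 3 ≠ b ^ 3) (k : ℕ) {q : ℝ}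
    (hq : q ≠ 0) {t : ℝ} (ht : t = |a| * Real.exp q) :
    t * (Real.log t ^ k *
        (t * (t + a) / ((t ^ 3 - a ^ 3) * (t ^ 2 + b * t + b ^ 2))
          + t * (t - a) / ((t ^ 3 + a ^ 3) * (t ^ 2 - b * t + b ^ 2))))
      = 2 * (1 / (3 * (a ^ 2 + a * b + b ^ 2))) * Real.log |a| ^ k * kerCoth q
        + regularPart (1 / (3 * (a ^ 2 + a * b + b ^ 2))) ((a + b) / (√3 * (a ^ 3 - b ^ 3)))
          (Real.log |a|) (Real.log |b|) k q := by
  have ha' : 0 < |a| := abs_pos.2 ha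
  have hb' : 0 < |b| := abs_pos.2 hb
  have ht0 : 0 < t := by rw [ht]; positivity
  have hlog : Real.log t = q + Real.log |a| := by
    rw [ht, Real.log_mul ha'.ne' (Real.exp_pos q).ne', Real.log_exp, add_comm]
  have hqa : q = Real.log (t / |a|) := by
    rw [Real.log_div ht0.ne' ha'.ne', hlog, add_sub_cancel_right]
  have hqb : q - (Real.log |b| - Real.log |a|) = Real.log (t / |b|) := by
    rw [Real.log_div ht0.ne' hb'.ne', hlog]; ring
  have hta : t ^ 2 ≠ a ^ 2 := by
    rw [← sq_abs a]
    intro h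
    have h1 : t = |a| := (pow_left_inj₀ ht0.le ha'.le two_ne_zero).1 h
    rw [h1, div_self ha'.ne', Real.log_one] at hqa
    exact hq hqa
  have h4 (x : ℝ) : |x| ^ 4 = x ^ 4 := (by decide : Even 4).pow_abs x
  have hK := kerCoth_add_sign ha' ht0
  have hEa := kerOdd_add_sign ha' ht0
  have hEb := kerOdd_add_sign hb' ht0
  have hBa := kerEven_log ha' ht0
  have hBb := kerEven_log hb' ht0
  rw [← hqa] at hK hEa hBa
  rw [← hqb] at hEb hBb
  simp only [h4, sq_abs] at hK hEa hEb hBa hBb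
  have h3 : √3 ≠ 0 := by positivity
  have hκ : (a + b) / (√3 * (a ^ 3 - b ^ 3)) * √3 = (a + b) / (a ^ 3 - b ^ 3) := by
    field_simp
  have hpf := partial_fractions ha hb hab hta
  rw [← hK, ← hEa, ← hEb, ← hκ] at hpf
  rw [mul_div_assoc] at hBa hBb
  rw [hlog, regularPart, show q - (Real.log |b| - Real.log |a|) + Real.log |b| = q + Real.log |a|
    by ring, hBa, hBb]
  linear_combination (q + Real.log |a|) ^ k * hpf

end CubicLogIntegral

open CubicLogIntegral

/-- `g₁(k) + g₂(k)` for nonzero real `a`, `b` with `a³ ≠ b³`, as a Cauchy principal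
value (pole at `t = |a|`), in terms of the recursive polynomials
`R_k`, `S_k`, `P_k`, `Q_k`, `Y_k`, `Z_k`, with `θ = 2π/3` and `δ = π/3`. -/
theorem g1_add_g2_eval (a b : ℝ) (ha : a ≠ 0) (hb : b ≠ 0) (hab : a ^ 3 ≠ b ^ 3) (k : ℕ) :
    Filter.Tendsto (fun ε : ℝ =>
        (∫ t in Set.Ioo (0 : ℝ) (|a| - ε),
            Real.log t ^ k *
              (t * (t + a) / ((t ^ 3 - a ^ 3) * (t ^ 2 + b * t + b ^ 2))
                + t * (t - a) / ((t ^ 3 + a ^ 3) * (t ^ 2 - b * t + b ^ 2))))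
        + ∫ t in Set.Ioi (|a| + ε),
            Real.log t ^ k *
              (t * (t + a) / ((t ^ 3 - a ^ 3) * (t ^ 2 + b * t + b ^ 2))
                + t * (t - a) / ((t ^ 3 + a ^ 3) * (t ^ 2 - b * t + b ^ 2))))
      (nhdsWithin 0 (Set.Ioi 0))
      (nhds ((2 * Real.pi / 3) ^ (k + 1) / (3 * (a ^ 2 + a * b + b ^ 2)) *
          (-(Rpoly k).eval (Real.log |a| / (2 * Real.pi / 3))
            + 3 * (Rpoly k).eval (Real.log |b| / (2 * Real.pi / 3))
            + (Ypoly k).eval (Real.log |a| / (2 * Real.pi / 3)))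
        + (2 * Real.pi / 3) ^ (k + 1) * (a + b) / (Real.sqrt 3 * (a ^ 3 - b ^ 3)) *
          ((Spoly k).eval (Real.log |a| / (2 * Real.pi / 3))
            - (Spoly k).eval (Real.log |b| / (2 * Real.pi / 3)))
        + (Real.pi / 3) ^ (k + 1) / (3 * (a ^ 2 + a * b + b ^ 2)) *
          (-(Ppoly k).eval (Real.log |a| / (Real.pi / 3))
            + 3 * (Ppoly k).eval (Real.log |b| / (Real.pi / 3))
            + (Zpoly k).eval (Real.log |a| / (Real.pi / 3)))
        + (Real.pi / 3) ^ (k + 1) * (a + b) / (Real.sqrt 3 * (a ^ 3 - b ^ 3)) *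
          ((Qpoly k).eval (Real.log |a| / (Real.pi / 3))
            - (Qpoly k).eval (Real.log |b| / (Real.pi / 3))))) := by
  have h := tendsto_principalValue (f := fun t => Real.log t ^ k *
      (t * (t + a) / ((t ^ 3 - a ^ 3) * (t ^ 2 + b * t + b ^ 2))
        + t * (t - a) / ((t ^ 3 + a ^ 3) * (t ^ 2 - b * t + b ^ 2)))) (abs_pos.2 ha)
    (2 * (1 / (3 * (a ^ 2 + a * b + b ^ 2)))
    * Real.log |a| ^ k) (integrable_regularPart (1 / (3 * (a ^ 2 + a * b + b ^ 2)))
      ((a + b) / (√3 * (a ^ 3 - b ^ 3))) (Real.log |a|) (Real.log |b|) k)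
    (fun q hq => integrand_eq ha hb hab k hq rfl)
  convert! h using 2
  rw [integral_regularPart]
  set c : ℝ := 1 / (3 * (a ^ 2 + a * b + b ^ 2)) with hc
  set κ : ℝ := (a + b) / (√3 * (a ^ 3 - b ^ 3)) with hκ
  have hk : (k + 1 : ℂ) ≠ 0 := by exact_mod_cast k.succ_ne_zero
  have e1 := combination_even (Real.log |a|) (Real.log |b|) k
  have e2 := combination_odd (Real.log |a|) k
  have e3 := combination_odd (Real.log |b|) k
  have m1 := integral_kerCoth_shift (Real.log |a|) k
  have m2 := integral_kerOdd_shift (Real.log |a|) k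
  have m3 := integral_kerOdd_shift (Real.log |b|) k
  have m4 := integral_kerEven_shift (Real.log |a|) k
  have m5 := integral_kerEven_shift (Real.log |b|) k
  rw [div_eq_mul_one_div ((2 * Real.pi / 3) ^ (k + 1)),
    div_eq_mul_one_div ((Real.pi / 3) ^ (k + 1)),
    mul_div_assoc ((2 * Real.pi / 3) ^ (k + 1)), mul_div_assoc ((Real.pi / 3) ^ (k + 1)),
    ← hc, ← hκ]
  generalize (Rpoly k).eval (Real.log |a| / (2 * Real.pi / 3)) = Ra at *
  generalize (Rpoly k).eval (Real.log |b| / (2 * Real.pi / 3)) = Rb at *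
  generalize (Ypoly k).eval (Real.log |a| / (2 * Real.pi / 3)) = Ya at *
  generalize (Spoly k).eval (Real.log |a| / (2 * Real.pi / 3)) = Sa at *
  generalize (Spoly k).eval (Real.log |b| / (2 * Real.pi / 3)) = Sb at *
  generalize (Ppoly k).eval (Real.log |a| / (Real.pi / 3)) = Pa at *
  generalize (Ppoly k).eval (Real.log |b| / (Real.pi / 3)) = Pb at *
  generalize (Zpoly k).eval (Real.log |a| / (Real.pi / 3)) = Za at *
  generalize (Qpoly k).eval (Real.log |a| / (Real.pi / 3)) = Qa at *
  generalize (Qpoly k).eval (Real.log |b| / (Real.pi / 3)) = Qb at *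
  rw [eq_div_iff hk] at m1 m2 m3 m4 m5
  have hsum : (2 * (Real.log |b| ^ (k + 1) - Real.log |a| ^ (k + 1)) / (k + 1) : ℂ) * (k + 1)
      = 2 * (Real.log |b| ^ (k + 1) - Real.log |a| ^ (k + 1)) := div_mul_cancel₀ _ hk
  apply Complex.ofReal_injective
  refine mul_right_cancel₀ hk ?_
  push_cast at e1 e2 e3 m1 m2 m3 m4 m5 hsum ⊢
  linear_combination (c : ℂ) * e1 + (κ : ℂ) * (e2 - e3) - 2 * (c : ℂ) * m1
    - (c : ℂ) * (m2 - 3 * m3 + 3 * hsum) - (κ : ℂ) * (m4 - m5)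
end

section
/- Let a, b be positive real numbers with a ≠ b, let β be a real number with −1 < β < 3 and β ∉ {0, 1, 2}, and set θ = 2π/3. Then ∫₀^∞ x^β / ((x² + a x + a²)(x² + b x + b²)) dx = (π/(2√3(a³−b³))) · [ (a^β − b^β) · csc(θ(β−1)/2 + θ/2) · csc(θ(β−1)/2) − (b a^{β−1} − a b^{β−1}) · csc(θ(β−1)/2 − θ/2) · csc(θ(β−1)/2) ]. -/
open MeasureTheory

/-- The Laplace transform of `t ^ (s - 1)` on the right half-plane. -/
theorem integral_rpow_mul_cexp_neg_mul_Ioi {s : ℝ} (hs : 0 < s) {z : ℂ} (hz : 0 < z.re) :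
    ∫ t in Set.Ioi (0 : ℝ), ((t ^ (s - 1) : ℝ) : ℂ) * Complex.exp (-(z * t)) =
      Real.Gamma s * z ^ (-s : ℂ) := by
  set μ : Measure ℝ := (volume.restrict (Set.Ioi 0)).withDensity
    (fun t => ((t ^ (s - 1)).toNNReal : ENNReal)) with hμ
  have hmeas : Measurable fun t : ℝ => (t ^ (s - 1)).toNNReal := by fun_prop
  have hset : Set.Iio (0 : ℝ) ⊆ interior (ProbabilityTheory.integrableExpSet id μ) := by
    refine interior_maximal (fun w hw => ?_) isOpen_Iio
    have h := integrableOn_rpow_mul_exp_neg_mul_rpow (s := s - 1) (by linarith) one_pos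
      (neg_pos.2 hw)
    simp only [ProbabilityTheory.integrableExpSet, Set.mem_ofPred_eq]
    rw [hμ, integrable_withDensity_iff_integrable_smul hmeas]
    refine h.congr_fun (fun t ht => ?_) measurableSet_Ioi
    simp [NNReal.smul_def, Real.rpow_nonneg (le_of_lt (Set.mem_Ioi.1 ht))]
  have hF : ∀ w : ℂ, ∫ t in Set.Ioi (0 : ℝ), ((t ^ (s - 1) : ℝ) : ℂ) * Complex.exp (-(w * t)) =
      ProbabilityTheory.complexMGF id μ (-w) := by
    intro w
    rw [ProbabilityTheory.complexMGF, hμ, integral_withDensity_eq_integral_smul hmeas]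
    refine setIntegral_congr_fun measurableSet_Ioi (fun t ht => ?_)
    simp [NNReal.smul_def, Real.rpow_nonneg (le_of_lt (Set.mem_Ioi.1 ht))]
  have hopen : IsOpen {w : ℂ | 0 < w.re} := isOpen_lt continuous_const Complex.continuous_re
  have hf : AnalyticOnNhd ℂ (fun w => ProbabilityTheory.complexMGF id μ (-w))
      {w : ℂ | 0 < w.re} := by
    refine ProbabilityTheory.analyticOnNhd_complexMGF.comp (g := ProbabilityTheory.complexMGF id μ)
      (f := fun w : ℂ => -w) (fun w _ => analyticAt_id.neg) (fun w hw => hset ?_)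
    simpa using hw
  have hg : AnalyticOnNhd ℂ (fun w : ℂ => (Real.Gamma s : ℂ) * w ^ (-s : ℂ))
      {w : ℂ | 0 < w.re} := by
    refine DifferentiableOn.analyticOnNhd (fun w hw => ?_) hopen
    have : w ∈ Complex.slitPlane := Or.inl hw
    exact ((differentiableAt_id.cpow_const this).const_mul _).differentiableWithinAt
  have hreal : ∀ r : ℝ, 0 < r → ProbabilityTheory.complexMGF id μ (-(r : ℂ)) =
      (Real.Gamma s : ℂ) * (r : ℂ) ^ (-s : ℂ) := by
    intro r hr
    have h := Real.integral_rpow_mul_exp_neg_mul_Ioi hs hr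
    rw [← hF, ← Complex.ofReal_neg, ← Complex.ofReal_cpow hr.le, ← Complex.ofReal_mul,
      Real.rpow_neg hr.le, ← Real.inv_rpow hr.le, mul_comm, ← one_div, ← h]
    simp only [← Complex.ofReal_mul, ← Complex.ofReal_neg, ← Complex.ofReal_exp]
    exact integral_ofReal
  rw [hF]
  refine hf.eqOn_of_preconnected_of_frequently_eq hg (z₀ := 1)
    ((convex_halfSpace_re_gt 0).isPreconnected) (by simp) ?_ hz
  have htend : Filter.Tendsto (fun x : ℝ => (x : ℂ)) (nhdsWithin 1 {1}ᶜ) (nhdsWithin 1 {1}ᶜ) := by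
    refine tendsto_nhdsWithin_iff.2 ⟨?_, ?_⟩
    · exact (Complex.continuous_ofReal.tendsto' 1 1 (by simp)).mono_left nhdsWithin_le_nhds
    · filter_upwards [self_mem_nhdsWithin] with x hx
      simpa using hx
  refine htend.frequently (Filter.Eventually.frequently ?_)
  filter_upwards [nhdsWithin_le_nhds (lt_mem_nhds one_pos)] with x hx
  exact hreal x hx

/-- The Mellin transform of `(x + z)⁻¹`, as a convergent integral. -/
theorem integral_rpow_div_add {s : ℝ} (hs : 0 < s) (hs1 : s < 1) {z : ℂ} (hz : 0 < z.re) :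
    IntegrableOn (fun x : ℝ => ((x ^ (s - 1) : ℝ) : ℂ) / (x + z)) (Set.Ioi 0) ∧
    ∫ x in Set.Ioi (0 : ℝ), ((x ^ (s - 1) : ℝ) : ℂ) / (x + z) =
      (Real.pi / Real.sin (Real.pi * s) : ℝ) * z ^ ((s - 1 : ℝ) : ℂ) := by
  set ν : Measure ℝ := volume.restrict (Set.Ioi 0)
  set f : ℝ → ℝ → ℂ := fun t x => ((x ^ (s - 1) : ℝ) : ℂ) * Complex.exp (-((x + z) * t)) with hf
  have hpos : ∀ᵐ t ∂ν, 0 < t := ae_restrict_mem measurableSet_Ioi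
  have hnorm : ∀ t x : ℝ, 0 < x →
      ‖f t x‖ = Real.exp (-(z.re * t)) * (x ^ (s - 1) * Real.exp (-(t * x))) := by
    intro t x hx
    rw [hf, norm_mul, Complex.norm_exp, Complex.norm_real, Real.norm_eq_abs,
      abs_of_nonneg (Real.rpow_nonneg hx.le _), mul_left_comm, ← Real.exp_add]
    congr 2
    simp
    ring
  have hmeas : Measurable (Function.uncurry f) := by
    simp only [hf, Function.uncurry_def]
    fun_prop
  have hsec : ∀ᵐ t ∂ν, Integrable (f t) ν := by
    filter_upwards [hpos] with t ht
    have h := integrableOn_rpow_mul_exp_neg_mul_rpow (s := s - 1) (by linarith) one_pos ht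
    refine (Integrable.const_mul h (Real.exp (-(z.re * t)))).mono'
      (hmeas.comp measurable_prodMk_left).aestronglyMeasurable ?_
    filter_upwards [hpos] with x hx
    rw [hnorm t x hx]
    simp
  have hint : Integrable (Function.uncurry f) (ν.prod ν) := by
    rw [integrable_prod_iff hmeas.aestronglyMeasurable]
    refine ⟨hsec, ?_⟩
    have h := integrableOn_rpow_mul_exp_neg_mul_rpow (s := -s) (by linarith) one_pos hz
    refine (Integrable.const_mul h (Real.Gamma s)).congr ?_
    filter_upwards [hpos] with t ht
    have h1 : ∫ x, ‖Function.uncurry f (t, x)‖ ∂ν =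
        ∫ x, Real.exp (-(z.re * t)) * (x ^ (s - 1) * Real.exp (-(t * x))) ∂ν := by
      refine integral_congr_ae ?_
      filter_upwards [hpos] with x hx using hnorm t x hx
    rw [h1, integral_const_mul, Real.integral_rpow_mul_exp_neg_mul_Ioi hs ht, one_div,
      Real.inv_rpow ht.le, ← Real.rpow_neg ht.le]
    simp
    ring
  have hinner : ∀ x : ℝ, 0 < x → ∫ t, f t x ∂ν = ((x ^ (s - 1) : ℝ) : ℂ) / (x + z) := by
    intro x hx
    have h := integral_exp_mul_complex_Ioi (a := -(x + z)) (by simp; linarith) 0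
    simp only [hf, ← neg_mul]
    rw [integral_const_mul, h]
    simp [div_eq_mul_inv, -neg_add_rev]
  have hinner_ae : (fun x : ℝ => ∫ t, f t x ∂ν) =ᵐ[ν]
      fun x : ℝ => ((x ^ (s - 1) : ℝ) : ℂ) / (x + z) := by
    filter_upwards [hpos] with x hx using hinner x hx
  refine ⟨(hint.integral_prod_right).congr hinner_ae, ?_⟩
  rw [← integral_congr_ae hinner_ae, ← integral_integral_swap hint]
  have houter : ∀ᵐ t ∂ν, ∫ x, f t x ∂ν =
      Real.Gamma s * (((t ^ ((1 - s) - 1) : ℝ) : ℂ) * Complex.exp (-(z * t))) := by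
    filter_upwards [hpos] with t ht
    have h := integral_rpow_mul_cexp_neg_mul_Ioi hs (z := (t : ℂ)) (by simpa using ht)
    have h2 : ∀ x, f t x = Complex.exp (-(z * t)) *
        (((x ^ (s - 1) : ℝ) : ℂ) * Complex.exp (-(t * x))) := by
      intro x
      simp only [hf]
      rw [mul_left_comm, ← Complex.exp_add]
      ring_nf
    simp only [h2]
    rw [integral_const_mul, h, ← Complex.ofReal_neg, ← Complex.ofReal_cpow ht.le,
      show 1 - s - 1 = -s by ring]
    ring
  rw [integral_congr_ae houter, integral_const_mul,
    integral_rpow_mul_cexp_neg_mul_Ioi (by linarith) hz, ← mul_assoc, ← Complex.ofReal_mul,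
    Real.Gamma_mul_Gamma_one_sub]
  congr 2
  push_cast
  ring

/-- The Mellin transform of a proper fraction with denominator `x ^ 2 + a * x + a ^ 2`. -/
theorem integral_rpow_mul_div_quadratic {a γ : ℝ} (ha : 0 < a) (hγ : -1 < γ) (hγ' : γ < 0)
    (A B : ℝ) :
    IntegrableOn (fun x : ℝ => x ^ γ * ((A * x + B) / (x ^ 2 + a * x + a ^ 2))) (Set.Ioi 0) ∧
    ∫ x in Set.Ioi (0 : ℝ), x ^ γ * ((A * x + B) / (x ^ 2 + a * x + a ^ 2)) =
      -(Real.pi / Real.sin (Real.pi * γ)) * a ^ γ *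
        (A * Real.cos (Real.pi / 3 * γ)
          - (2 * B - A * a) / (√3 * a) * Real.sin (Real.pi / 3 * γ)) := by
  have h3 : 0 < √3 := by positivity
  have h3' : √3 ^ 2 = 3 := Real.sq_sqrt (by norm_num)
  set z : ℂ := a * (Real.cos (Real.pi / 3) + Real.sin (Real.pi / 3) * Complex.I) with hz
  have hre : z.re = a / 2 := by
    simp [hz, -Complex.ofReal_cos, -Complex.ofReal_sin, Real.cos_pi_div_three]; ring
  have him : z.im = √3 / 2 * a := by
    simp [hz, -Complex.ofReal_cos, -Complex.ofReal_sin, Real.sin_pi_div_three]; ring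
  have harg : z.arg = Real.pi / 3 := by
    rw [hz, Complex.ofReal_cos, Complex.ofReal_sin]
    exact Complex.arg_mul_cos_add_sin_mul_I ha ⟨by linarith [Real.pi_pos], by linarith [Real.pi_pos]⟩
  have habs : ‖z‖ = a := by
    rw [hz, Complex.ofReal_cos, Complex.ofReal_sin, norm_mul, Complex.norm_cos_add_sin_mul_I]
    simp [ha.le]
  obtain ⟨hi, he⟩ := integral_rpow_div_add (s := γ + 1) (by linarith) (by linarith)
    (z := z) (by rw [hre]; positivity)
  simp only [add_sub_cancel_right] at hi he
  have hfr : ∀ x : ℝ, 0 < x → x ^ γ * ((A * x + B) / (x ^ 2 + a * x + a ^ 2)) =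
      A * RCLike.re (((x ^ γ : ℝ) : ℂ) / (x + z)) -
        (2 * B - A * a) / (√3 * a) * RCLike.im (((x ^ γ : ℝ) : ℂ) / (x + z)) := by
    intro x hx
    have hq : x ^ 2 + a * x + a ^ 2 ≠ 0 := by positivity
    have hns : Complex.normSq (x + z) = x ^ 2 + a * x + a ^ 2 := by
      rw [Complex.normSq_apply]
      simp only [Complex.add_re, Complex.add_im, Complex.ofReal_re, Complex.ofReal_im, hre, him]
      linear_combination a ^ 2 / 4 * h3'
    simp only [RCLike.re_to_complex, RCLike.im_to_complex, Complex.div_re, Complex.div_im, hns,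
      Complex.add_re, Complex.add_im, Complex.ofReal_re, Complex.ofReal_im, hre, him]
    field_simp
    ring
  have hi' := (Integrable.const_mul hi.re A).sub
    (Integrable.const_mul hi.im ((2 * B - A * a) / (√3 * a)))
  refine ⟨IntegrableOn.congr_fun hi' (fun x hx => (hfr x hx).symm) measurableSet_Ioi, ?_⟩
  rw [setIntegral_congr_fun measurableSet_Ioi hfr,
    integral_sub (Integrable.const_mul hi.re A) (Integrable.const_mul hi.im _),
    integral_const_mul, integral_const_mul, integral_re hi, integral_im hi, he]
  have hsin : Real.sin (Real.pi * (γ + 1)) = -Real.sin (Real.pi * γ) := by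
    rw [mul_add, mul_one, Real.sin_add_pi]
  rw [RCLike.re_to_complex, RCLike.im_to_complex, Complex.re_ofReal_mul, Complex.im_ofReal_mul,
    Complex.cpow_ofReal_re, Complex.cpow_ofReal_im, habs, harg, hsin, div_neg]
  ring

theorem sin_mul_sin_mul_sin (y : ℝ) :
    Real.sin y * Real.sin (y - Real.pi / 3) * Real.sin (y - 2 * (Real.pi / 3)) =
      Real.sin (3 * y) / 4 := by
  have h3 : √3 ^ 2 = 3 := Real.sq_sqrt (by norm_num)
  rw [show y - 2 * (Real.pi / 3) = y + Real.pi / 3 - Real.pi by ring, Real.sin_sub_pi,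
    Real.sin_sub, Real.sin_add, Real.sin_three_mul, Real.cos_pi_div_three, Real.sin_pi_div_three]
  linear_combination Real.sin y * (Real.cos y ^ 2 / 4) * h3 +
    3 / 4 * Real.sin y * Real.sin_sq_add_cos_sq y

theorem sin_pi_div_three_mul_ne_zero {t : ℝ} (h1 : -3 < t) (h2 : t < 3) (h0 : t ≠ 0) :
    Real.sin (Real.pi / 3 * t) ≠ 0 := by
  rw [Ne, Real.sin_eq_zero_iff_of_lt_of_lt]
  · have := Real.pi_pos
    positivity
  · nlinarith [Real.pi_pos]
  · nlinarith [Real.pi_pos]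

/-- Evaluation of `∫₀^∞ x ^ (γ + m) / ((x ^ 2 + a x + a ^ 2) (x ^ 2 + b x + b ^ 2)) dx` from a
partial fraction decomposition of the rational function multiplying `x ^ γ`. -/
theorem integral_of_partial_fraction {a b γ : ℝ} (ha : 0 < a) (hb : 0 < b) (hab : a ≠ b)
    (hγ : -1 < γ) (hγ' : γ < 0) (m : ℕ) (A B C D : ℝ)
    (hpf : ∀ x : ℝ, x ^ m * (b ^ 3 - a ^ 3) =
      (A * x + B) * (x ^ 2 + b * x + b ^ 2) - (C * x + D) * (x ^ 2 + a * x + a ^ 2))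
    (hA : (-1) ^ m * (A * Real.cos (Real.pi / 3 * γ)
        - (2 * B - A * a) / (√3 * a) * Real.sin (Real.pi / 3 * γ)) =
      2 / √3 * (a ^ m / a) * (a * Real.sin (Real.pi / 3 * (γ + m) - 2 * (Real.pi / 3)) -
        b * Real.sin (Real.pi / 3 * (γ + m))))
    (hC : (-1) ^ m * (C * Real.cos (Real.pi / 3 * γ)
        - (2 * D - C * b) / (√3 * b) * Real.sin (Real.pi / 3 * γ)) =
      2 / √3 * (b ^ m / b) * (b * Real.sin (Real.pi / 3 * (γ + m) - 2 * (Real.pi / 3)) -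
        a * Real.sin (Real.pi / 3 * (γ + m)))) :
    ∫ x in Set.Ioi (0 : ℝ),
        x ^ (γ + m) / ((x ^ 2 + a * x + a ^ 2) * (x ^ 2 + b * x + b ^ 2)) =
      2 * Real.pi / (√3 * (a ^ 3 - b ^ 3) * Real.sin (Real.pi * (γ + m))) *
        (a ^ (γ + m - 1) * (a * Real.sin (Real.pi / 3 * (γ + m) - 2 * (Real.pi / 3)) -
            b * Real.sin (Real.pi / 3 * (γ + m))) -
          b ^ (γ + m - 1) * (b * Real.sin (Real.pi / 3 * (γ + m) - 2 * (Real.pi / 3)) -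
            a * Real.sin (Real.pi / 3 * (γ + m)))) := by
  have hne : b ^ 3 - a ^ 3 ≠ 0 := by
    rw [sub_ne_zero]
    exact fun h => hab ((pow_left_inj₀ ha.le hb.le three_ne_zero).1 h.symm)
  obtain ⟨ia, ea⟩ := integral_rpow_mul_div_quadratic ha hγ hγ' A B
  obtain ⟨ib, eb⟩ := integral_rpow_mul_div_quadratic hb hγ hγ' C D
  have hdecomp : ∀ x ∈ Set.Ioi (0 : ℝ),
      x ^ (γ + m) / ((x ^ 2 + a * x + a ^ 2) * (x ^ 2 + b * x + b ^ 2)) =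
      (b ^ 3 - a ^ 3)⁻¹ * (x ^ γ * ((A * x + B) / (x ^ 2 + a * x + a ^ 2)) -
        x ^ γ * ((C * x + D) / (x ^ 2 + b * x + b ^ 2))) := by
    intro x hx
    have hx : 0 < x := hx
    have hqa : x ^ 2 + a * x + a ^ 2 ≠ 0 := by positivity
    have hqb : x ^ 2 + b * x + b ^ 2 ≠ 0 := by positivity
    rw [Real.rpow_add hx, Real.rpow_natCast, ← mul_sub, div_sub_div _ _ hqa hqb,
      mul_comm (x ^ 2 + a * x + a ^ 2) (C * x + D), ← hpf x]
    field_simp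
  have hsin : Real.sin (Real.pi * (γ + m)) = (-1) ^ m * Real.sin (Real.pi * γ) := by
    rw [mul_add, mul_comm Real.pi (m : ℝ), Real.sin_add_nat_mul_pi]
  have hpow : ∀ {c : ℝ}, 0 < c → c ^ (γ + m - 1) = c ^ γ * (c ^ m / c) := by
    intro c hc
    rw [Real.rpow_sub_one hc.ne', Real.rpow_add hc, Real.rpow_natCast, mul_div_assoc]
  have hsq : ((-1 : ℝ) ^ m) * (-1) ^ m = 1 := by rw [← mul_pow]; norm_num
  have hsgn : ((-1 : ℝ) ^ m)⁻¹ = (-1) ^ m := inv_eq_of_mul_eq_one_left hsq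
  rw [setIntegral_congr_fun measurableSet_Ioi hdecomp, integral_const_mul, integral_sub ia ib, ea,
    eb, hsin, hpow ha, hpow hb, ← neg_sub (a ^ 3) (b ^ 3), inv_neg, div_eq_mul_inv,
    div_eq_mul_inv (2 * Real.pi), mul_inv, mul_inv, mul_inv, hsgn]
  linear_combination (a ^ 3 - b ^ 3)⁻¹ * Real.pi * (Real.sin (Real.pi * γ))⁻¹ * (-1) ^ m *
      (a ^ γ * hA - b ^ γ * hC) - (a ^ 3 - b ^ 3)⁻¹ * Real.pi * (Real.sin (Real.pi * γ))⁻¹ *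
      (a ^ γ * (A * Real.cos (Real.pi / 3 * γ)
        - (2 * B - A * a) / (√3 * a) * Real.sin (Real.pi / 3 * γ)) -
      b ^ γ * (C * Real.cos (Real.pi / 3 * γ)
        - (2 * D - C * b) / (√3 * b) * Real.sin (Real.pi / 3 * γ))) * hsq

theorem integral_rpow_div_quadratic_mul_quadratic {a b β : ℝ} (ha : 0 < a) (hb : 0 < b)
    (hab : a ≠ b) (hβ₁ : -1 < β) (hβ₂ : β < 3) (h0 : β ≠ 0) (h1 : β ≠ 1) (h2 : β ≠ 2) :
    ∫ x in Set.Ioi (0 : ℝ), x ^ β / ((x ^ 2 + a * x + a ^ 2) * (x ^ 2 + b * x + b ^ 2)) =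
      2 * Real.pi / (√3 * (a ^ 3 - b ^ 3) * Real.sin (Real.pi * β)) *
        (a ^ (β - 1) * (a * Real.sin (Real.pi / 3 * β - 2 * (Real.pi / 3)) -
            b * Real.sin (Real.pi / 3 * β)) -
          b ^ (β - 1) * (b * Real.sin (Real.pi / 3 * β - 2 * (Real.pi / 3)) -
            a * Real.sin (Real.pi / 3 * β))) := by
  have h3 : √3 ^ 2 = 3 := Real.sq_sqrt (by norm_num)
  have h3' : √3 ≠ 0 := by positivity
  have sin_sub_one : ∀ u : ℝ, Real.sin (u - Real.pi / 3) =
      Real.sin u / 2 - √3 / 2 * Real.cos u := by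
    intro u
    rw [Real.sin_sub, Real.cos_pi_div_three, Real.sin_pi_div_three]; ring
  have sin_add_one : ∀ u : ℝ, Real.sin (u + Real.pi / 3) =
      Real.sin u / 2 + √3 / 2 * Real.cos u := by
    intro u
    rw [Real.sin_add, Real.cos_pi_div_three, Real.sin_pi_div_three]; ring
  have sin_sub_two : ∀ u : ℝ, Real.sin (u - 2 * (Real.pi / 3)) =
      -(Real.sin u / 2 + √3 / 2 * Real.cos u) := by
    intro u
    rw [← sin_add_one, ← Real.sin_sub_pi]; ring_nf
  have sin_add_two : ∀ u : ℝ, Real.sin (u + 2 * (Real.pi / 3)) =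
      -(Real.sin u / 2 - √3 / 2 * Real.cos u) := by
    intro u
    rw [← sin_sub_one, ← Real.sin_add_pi]; ring_nf
  rcases lt_or_gt_of_ne h0 with h | h
  · have := integral_of_partial_fraction ha hb hab hβ₁ h 0 (-1) b (-1) a (fun x => by ring)
    simp only [Nat.cast_zero, add_zero, sin_sub_two] at this ⊢
    apply this <;> field_simp <;> ring
  rcases lt_or_gt_of_ne h1 with h' | h'
  · have := integral_of_partial_fraction (γ := β - 1) ha hb hab (by linarith) (by linarith) 1
      (a + b) (a ^ 2) (a + b) (b ^ 2) (fun x => by ring)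
    simp only [Nat.cast_one, sub_add_cancel] at this
    obtain ⟨u, hu⟩ : ∃ u, u = Real.pi / 3 * (β - 1) := ⟨_, rfl⟩
    have e1 : Real.pi / 3 * β = u + Real.pi / 3 := by rw [hu]; ring
    have e2 : u + Real.pi / 3 - 2 * (Real.pi / 3) = u - Real.pi / 3 := by ring
    rw [← hu, e1, e2, sin_add_one, sin_sub_one] at this
    rw [e1, e2, sin_add_one, sin_sub_one]
    apply this <;> field_simp <;> ring
  rcases lt_or_gt_of_ne h2 with h'' | h''
  · have := integral_of_partial_fraction (γ := β - 2) ha hb hab (by linarith) (by linarith) 2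
      (-(a * b)) (-(a ^ 2 * (a + b))) (-(a * b)) (-(b ^ 2 * (a + b))) (fun x => by ring)
    simp only [Nat.cast_ofNat, sub_add_cancel] at this
    obtain ⟨u, hu⟩ : ∃ u, u = Real.pi / 3 * (β - 2) := ⟨_, rfl⟩
    have e1 : Real.pi / 3 * β = u + 2 * (Real.pi / 3) := by rw [hu]; ring
    rw [← hu, e1, add_sub_cancel_right, sin_add_two] at this
    rw [e1, add_sub_cancel_right, sin_add_two]
    apply this <;> field_simp <;> ring
  · have := integral_of_partial_fraction (γ := β - 3) ha hb hab (by linarith) (by linarith) 3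
      (-a ^ 3) (a ^ 3 * b) (-b ^ 3) (b ^ 3 * a) (fun x => by ring)
    simp only [Nat.cast_ofNat, sub_add_cancel] at this
    obtain ⟨u, hu⟩ : ∃ u, u = Real.pi / 3 * (β - 3) := ⟨_, rfl⟩
    have e1 : Real.pi / 3 * β = u + Real.pi := by rw [hu]; ring
    have e2 : u + Real.pi - 2 * (Real.pi / 3) = u + Real.pi / 3 := by ring
    rw [← hu, e1, e2, sin_add_one, Real.sin_add_pi] at this
    rw [e1, e2, sin_add_one, Real.sin_add_pi]
    apply this <;> field_simp <;> ring

/-- Evaluation of `I₁(β) = ∫₀^∞ x^β /((x²+ax+a²)(x²+bx+b²)) dx` for `−1 < β < 3`,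
`β ∉ {0,1,2}`, with `θ = 2π/3` and `csc x = 1/sin x`. -/
theorem I1_eval (a b : ℝ) (ha : 0 < a) (hb : 0 < b) (hab : a ≠ b)
    (β : ℝ) (hβ₁ : -1 < β) (hβ₂ : β < 3) (h0 : β ≠ 0) (h1 : β ≠ 1) (h2 : β ≠ 2) :
    ∫ x in Set.Ioi (0 : ℝ),
        x ^ β / ((x ^ 2 + a * x + a ^ 2) * (x ^ 2 + b * x + b ^ 2)) =
      Real.pi / (2 * Real.sqrt 3 * (a ^ 3 - b ^ 3)) *
        ((a ^ β - b ^ β) *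
            (Real.sin (2 * Real.pi / 3 * (β - 1) / 2 + (2 * Real.pi / 3) / 2))⁻¹ *
            (Real.sin (2 * Real.pi / 3 * (β - 1) / 2))⁻¹
          - (b * a ^ (β - 1) - a * b ^ (β - 1)) *
            (Real.sin (2 * Real.pi / 3 * (β - 1) / 2 - (2 * Real.pi / 3) / 2))⁻¹ *
            (Real.sin (2 * Real.pi / 3 * (β - 1) / 2))⁻¹) := by
  rw [integral_rpow_div_quadratic_mul_quadratic ha hb hab hβ₁ hβ₂ h0 h1 h2]
  have hp0 := sin_pi_div_three_mul_ne_zero (t := β) (by linarith) hβ₂ h0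
  have hp1 := sin_pi_div_three_mul_ne_zero (t := β - 1) (by linarith) (by linarith)
    (sub_ne_zero.2 h1)
  have hp2 := sin_pi_div_three_mul_ne_zero (t := β - 2) (by linarith) (by linarith)
    (sub_ne_zero.2 h2)
  have hprod := sin_mul_sin_mul_sin (Real.pi / 3 * β)
  have e1 : Real.pi / 3 * (β - 1) = Real.pi / 3 * β - Real.pi / 3 := by ring
  have e2 : Real.pi / 3 * (β - 2) = Real.pi / 3 * β - 2 * (Real.pi / 3) := by ring
  rw [e1] at hp1
  rw [e2] at hp2
  have hden : Real.sin (Real.pi * β) = 4 * (Real.sin (Real.pi / 3 * β) *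
      Real.sin (Real.pi / 3 * β - Real.pi / 3) *
      Real.sin (Real.pi / 3 * β - 2 * (Real.pi / 3))) := by
    rw [hprod, show 3 * (Real.pi / 3 * β) = Real.pi * β by ring]; ring
  have hne : a ^ 3 - b ^ 3 ≠ 0 := by
    rw [sub_ne_zero]
    exact fun h => hab ((pow_left_inj₀ ha.le hb.le three_ne_zero).1 h)
  rw [hden, show 2 * Real.pi / 3 * (β - 1) / 2 + 2 * Real.pi / 3 / 2 = Real.pi / 3 * β by ring,
    show 2 * Real.pi / 3 * (β - 1) / 2 - 2 * Real.pi / 3 / 2 =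
      Real.pi / 3 * β - 2 * (Real.pi / 3) by ring,
    show 2 * Real.pi / 3 * (β - 1) / 2 = Real.pi / 3 * β - Real.pi / 3 by ring,
    Real.rpow_sub_one ha.ne', Real.rpow_sub_one hb.ne']
  generalize Real.sin (Real.pi / 3 * β - 2 * (Real.pi / 3)) = p2 at *
  generalize Real.sin (Real.pi / 3 * β - Real.pi / 3) = p1 at *
  generalize Real.sin (Real.pi / 3 * β) = p0 at *
  field_simp
  ring
end
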